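/- arXiv:1101.3204 — 14 statements merged into one kernel-verified Lean document; each statement's English description precedes it below -/
import Mathlib

section
/- Suppose that for every i ≥ 1 one has 4·(a_{i+1}·c_i/c_{i+1} − a_i)·(a_i − a_{i−1}·c_{i−1}/c_i) > (b_i − b_{i−1})² and a_{i+1}/a_i > c_{i+1}/c_i. Then for every k ≥ 0 and every real x, p_k(x)² − p_{k−1}(x)·p_{k+1}(x) > 0. -/
/-- A real quadratic form with positive leading coefficient and negative discriminant is positive
away from the origin. -/
lemma quadratic_form_pos {α β γ u v : ℝ} (hα : 0 < α) (hdisc : β ^ 2 < 4 * α * γ)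
    (huv : u ≠ 0 ∨ v ≠ 0) : 0 < α * v ^ 2 + β * (u * v) + γ * u ^ 2 := by
  have key : 4 * α * (α * v ^ 2 + β * (u * v) + γ * u ^ 2)
      = (2 * α * v + β * u) ^ 2 + (4 * α * γ - β ^ 2) * u ^ 2 := by ring
  have hpos : 0 < (2 * α * v + β * u) ^ 2 + (4 * α * γ - β ^ 2) * u ^ 2 := by
    by_cases hu : u = 0
    · have hv : v ≠ 0 := huv.resolve_left (not_not.mpr hu)
      simp only [hu, mul_zero, add_zero, ne_eq, OfNat.ofNat_ne_zero, not_false_eq_true, zero_pow]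
      positivity
    · have : 0 < 4 * α * γ - β ^ 2 := by linarith
      positivity
  exact pos_of_mul_pos_right (key ▸ hpos) (by positivity)

/- Convention: `p n` denotes the paper's `p_{n-1}`, so `p 0 = p_{-1} = 0`, `p 1 = p_0 = 1`,
and the three-term recurrence `(a_k/c_k) p_k = (x - b_{k-1}) p_{k-1} - a_{k-1} c_{k-1} p_{k-2}`
(for `k ≥ 1`) reads `(a k / c k) * p (k+1) x = (x - b (k-1)) * p k x - a (k-1) * c (k-1) * p (k-1) x`. -/
theorem stmt_0 (a b c : ℕ → ℝ) (p : ℕ → ℝ → ℝ)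
    (ha0 : a 0 = 0) (hc0 : c 0 = 1)
    (hapos : ∀ k, 1 ≤ k → 0 < a k) (hcpos : ∀ k, 1 ≤ k → 0 < c k)
    (hp0 : ∀ x : ℝ, p 0 x = 0) (hp1 : ∀ x : ℝ, p 1 x = 1)
    (hrec : ∀ k, 1 ≤ k → ∀ x : ℝ, (a k / c k) * p (k + 1) x
      = (x - b (k - 1)) * p k x - a (k - 1) * c (k - 1) * p (k - 1) x)
    (hineq : ∀ i, 1 ≤ i →
      4 * (a (i + 1) * c i / c (i + 1) - a i) * (a i - a (i - 1) * c (i - 1) / c i)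
        > (b i - b (i - 1)) ^ 2)
    (hratio : ∀ i, 1 ≤ i → a (i + 1) / a i > c (i + 1) / c i) :
    ∀ k, ∀ x : ℝ, (p (k + 1) x) ^ 2 - p k x * p (k + 2) x > 0 := by
  intro k x
  induction k with
  | zero => simp [hp0, hp1]
  | succ n ih =>
    have hA : 0 < a (n + 1) := hapos _ (by omega)
    have hC : 0 < c (n + 1) := hcpos _ (by omega)
    have hA' : 0 < a (n + 2) := hapos _ (by omega)
    have hC' : 0 < c (n + 2) := hcpos _ (by omega)
    have hprev : 0 ≤ a n * c n := by
      rcases Nat.eq_zero_or_pos n with rfl | hn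
      · simp [ha0]
      · exact (mul_pos (hapos n hn) (hcpos n hn)).le
    have h1 : a (n + 1) / c (n + 1) * p (n + 2) x
        = (x - b n) * p (n + 1) x - a n * c n * p n x := hrec (n + 1) (by omega) x
    have h2 : a (n + 2) / c (n + 2) * p (n + 3) x
        = (x - b (n + 1)) * p (n + 2) x - a (n + 1) * c (n + 1) * p (n + 1) x :=
      hrec (n + 2) (by omega) x
    have hdisc : 4 * (a (n + 2) * c (n + 1) / c (n + 2) - a (n + 1))
        * (a (n + 1) - a n * c n / c (n + 1)) > (b (n + 1) - b n) ^ 2 :=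
      hineq (n + 1) (by omega)
    have hα : 0 < a (n + 2) / c (n + 2) - a (n + 1) / c (n + 1) := by
      have h := hratio (n + 1) (by omega)
      rw [gt_iff_lt, div_lt_div_iff₀ hC hA] at h
      rw [sub_pos, div_lt_div_iff₀ hC hC']
      linarith
    have hdisc' : (b (n + 1) - b n) ^ 2
        < 4 * (a (n + 2) / c (n + 2) - a (n + 1) / c (n + 1))
          * (a (n + 1) * c (n + 1) - a n * c n) := by
      refine lt_of_lt_of_eq hdisc ?_
      field_simp
    have huv : p (n + 1) x ≠ 0 ∨ p (n + 2) x ≠ 0 := by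
      by_contra! h
      simp [h.1, h.2] at ih
    have hquad := quadratic_form_pos hα hdisc' huv
    have hstep : a (n + 2) / c (n + 2) * (p (n + 2) x ^ 2 - p (n + 1) x * p (n + 3) x)
        = (a (n + 2) / c (n + 2) - a (n + 1) / c (n + 1)) * p (n + 2) x ^ 2
          + (b (n + 1) - b n) * (p (n + 1) x * p (n + 2) x)
          + (a (n + 1) * c (n + 1) - a n * c n) * p (n + 1) x ^ 2
          + a n * c n * (p (n + 1) x ^ 2 - p n x * p (n + 2) x) := by
      linear_combination p (n + 2) x * h1 - p (n + 1) x * h2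
    exact pos_of_mul_pos_right
      (hstep ▸ add_pos_of_pos_of_nonneg hquad (mul_nonneg hprev ih.le)) (by positivity)
end

section
/- Specialize the normalization to c_1 = 1 and c_k = 2^{k−1}·∏_{j=1}^{k−1}(a_{j+1}/a_j + a_j/a_{j+1})^{−1} for k ≥ 2. Suppose 0 = a_0 < a_1 < a_2 < ⋯ (the a_k strictly increasing), 2·(a_2² − a_1²) > (b_1 − b_0)², and (a_{k+1}² − a_k²)·(a_k² − a_{k−1}²)/a_k² > (b_k − b_{k−1})² for every k ≥ 2. Then for every k ≥ 0 and every real x, p_k(x)² − p_{k−1}(x)·p_{k+1}(x) > 0. -/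
lemma quadratic_form_nonneg {A B C : ℝ} (hA : 0 < A) (h : B ^ 2 < 4 * A * C) (u v : ℝ) :
    0 ≤ A * u ^ 2 + B * u * v + C * v ^ 2 := by
  have key : 4 * A * (A * u ^ 2 + B * u * v + C * v ^ 2)
      = (2 * A * u + B * v) ^ 2 + (4 * A * C - B ^ 2) * v ^ 2 := by ring
  have hd : 0 ≤ 4 * A * C - B ^ 2 := by linarith
  have : 0 ≤ 4 * A * (A * u ^ 2 + B * u * v + C * v ^ 2) := by rw [key]; positivity
  exact nonneg_of_mul_nonneg_right this (by positivity)

lemma quadratic_form_pos_s1 {A B C : ℝ} (hA : 0 < A) (h : B ^ 2 < 4 * A * C) (u : ℝ) {v : ℝ}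
    (hv : v ≠ 0) : 0 < A * u ^ 2 + B * u * v + C * v ^ 2 := by
  have key : 4 * A * (A * u ^ 2 + B * u * v + C * v ^ 2)
      = (2 * A * u + B * v) ^ 2 + (4 * A * C - B ^ 2) * v ^ 2 := by ring
  have hd : 0 < 4 * A * C - B ^ 2 := by linarith
  have : 0 < 4 * A * (A * u ^ 2 + B * u * v + C * v ^ 2) := by rw [key]; positivity
  exact pos_of_mul_pos_right this (by positivity)

/-- Recursion for Turán determinants of four consecutive terms `p, q, r, s` of a three-term
recurrence. -/
lemma turan_recursion {A E F G β β' x p q r s : ℝ} (h : E * r = (x - β) * q - G * p)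
    (h' : A * s = (x - β') * r - F * q) :
    A * (r ^ 2 - q * s)
      = G * (q ^ 2 - p * r) + ((A - E) * r ^ 2 + (β' - β) * r * q + (F - G) * q ^ 2) := by
  linear_combination r * h - q * h'

/-- Ratio of consecutive normalization constants. -/
lemma normalization_succ {a c : ℕ → ℝ} (hapos : ∀ k, 1 ≤ k → 0 < a k) (hc1 : c 1 = 1)
    (hck : ∀ k, 2 ≤ k → c k = 2 ^ (k - 1) *
      ∏ j ∈ Finset.Icc 1 (k - 1), (a (j + 1) / a j + a j / a (j + 1))⁻¹)
    {k : ℕ} (hk : 1 ≤ k) :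
    c (k + 1) = c k * (2 * (a k * a (k + 1)) / (a k ^ 2 + a (k + 1) ^ 2)) := by
  have h0 := hapos k hk
  have h1 := hapos (k + 1) (by omega)
  have hf : 2 * (a (k + 1) / a k + a k / a (k + 1))⁻¹
      = 2 * (a k * a (k + 1)) / (a k ^ 2 + a (k + 1) ^ 2) := by
    field_simp
    ring
  have hc : c k = 2 ^ (k - 1) *
      ∏ j ∈ Finset.Icc 1 (k - 1), (a (j + 1) / a j + a j / a (j + 1))⁻¹ := by
    rcases hk.eq_or_lt with rfl | hk
    · simp [hc1]
    · exact hck k hk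
  obtain ⟨m, rfl⟩ : ∃ m, k = m + 1 := ⟨k - 1, by omega⟩
  rw [hck (m + 1 + 1) (by omega), hc, ← hf]
  simp only [Nat.add_sub_cancel]
  rw [Finset.prod_Icc_succ_top (by omega : 1 ≤ m + 1), pow_succ]
  ring

/- Convention: `p n` denotes the paper's `p_{n-1}`, so `p 0 = p_{-1} = 0`, `p 1 = p_0 = 1`.
Here the normalization is specialized to `c 1 = 1` and
`c k = 2^(k-1) * ∏_{j=1}^{k-1} (a_{j+1}/a_j + a_j/a_{j+1})⁻¹` for `k ≥ 2`. -/
theorem stmt_1 (a b c : ℕ → ℝ) (p : ℕ → ℝ → ℝ)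
    (ha0 : a 0 = 0) (hc0 : c 0 = 1)
    (hapos : ∀ k, 1 ≤ k → 0 < a k) (hcpos : ∀ k, 1 ≤ k → 0 < c k)
    (hc1 : c 1 = 1)
    (hck : ∀ k, 2 ≤ k → c k = 2 ^ (k - 1) *
      ∏ j ∈ Finset.Icc 1 (k - 1), (a (j + 1) / a j + a j / a (j + 1))⁻¹)
    (hp0 : ∀ x : ℝ, p 0 x = 0) (hp1 : ∀ x : ℝ, p 1 x = 1)
    (hrec : ∀ k, 1 ≤ k → ∀ x : ℝ, (a k / c k) * p (k + 1) x
      = (x - b (k - 1)) * p k x - a (k - 1) * c (k - 1) * p (k - 1) x)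
    (hmono : StrictMono a)
    (h1 : 2 * (a 2 ^ 2 - a 1 ^ 2) > (b 1 - b 0) ^ 2)
    (h2 : ∀ k, 2 ≤ k →
      (a (k + 1) ^ 2 - a k ^ 2) * (a k ^ 2 - a (k - 1) ^ 2) / a k ^ 2
        > (b k - b (k - 1)) ^ 2) :
    ∀ k, ∀ x : ℝ, (p (k + 1) x) ^ 2 - p k x * p (k + 2) x > 0 := by
  have hA : ∀ n, 1 ≤ n → a (n + 1) / c (n + 1) - a n / c n
      = (a (n + 1) ^ 2 - a n ^ 2) / (2 * a n * c n) := by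
    intro n hn
    have h0 := hapos n hn
    have h1 := hapos (n + 1) (by omega)
    have h2 := hcpos n hn
    rw [normalization_succ hapos hc1 hck hn]
    field_simp
    ring
  have hF : ∀ n, 1 ≤ n → a (n + 1) * c (n + 1) - a n * c n
      = c (n + 1) * (a (n + 1) ^ 2 - a n ^ 2) / (2 * a (n + 1)) := by
    intro n hn
    have h0 := hapos n hn
    have h1 := hapos (n + 1) (by omega)
    have h2 := hcpos n hn
    rw [normalization_succ hapos hc1 hck hn]
    field_simp
    ring
  have hApos : ∀ n, 1 ≤ n → 0 < a (n + 1) / c (n + 1) - a n / c n := by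
    intro n hn
    have h0 := hapos n hn
    have h2 := hcpos n hn
    have h3 : a n < a (n + 1) := hmono (Nat.lt_succ_self n)
    rw [hA n hn]
    have : 0 < a (n + 1) ^ 2 - a n ^ 2 := by nlinarith
    positivity
  intro k x
  induction k with
  | zero => simp [hp0, hp1]
  | succ n ih =>
    have hr := hrec (n + 1) (by omega) x
    have hr' := hrec (n + 2) (by omega) x
    simp only [Nat.add_sub_cancel, show n + 2 - 1 = n + 1 by omega] at hr hr'
    have key := turan_recursion hr hr'
    have hpos : 0 < a (n + 2) / c (n + 2) :=
      div_pos (hapos _ (by omega)) (hcpos _ (by omega))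
    refine pos_of_mul_pos_right (a := a (n + 2) / c (n + 2)) ?_ hpos.le
    rw [show n + 1 + 2 = n + 2 + 1 by omega, show n + 1 + 1 = n + 2 by omega] at *
    rw [key]
    have hlead := hApos (n + 1) (by omega)
    rcases n.eq_zero_or_pos with rfl | hn
    · have hv : p (0 + 1) x ≠ 0 := by simp [hp1]
      have hd : (b (0 + 1) - b 0) ^ 2 < 4 * (a (0 + 2) / c (0 + 2) - a (0 + 1) / c (0 + 1))
          * (a (0 + 1) * c (0 + 1) - a 0 * c 0) := by
        have e := hA 1 le_rfl
        have := hapos 1 le_rfl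
        norm_num at e ⊢
        rw [e, ha0, hc1]
        refine lt_of_lt_of_eq h1 ?_
        field_simp
        ring
      have := quadratic_form_pos_s1 hlead hd (p (0 + 2) x) hv
      rw [ha0] at this ⊢
      linarith
    · have hd : (b (n + 1) - b n) ^ 2 < 4 * (a (n + 2) / c (n + 2) - a (n + 1) / c (n + 1))
          * (a (n + 1) * c (n + 1) - a n * c n) := by
        have h := h2 (n + 1) (by omega)
        have := hapos (n + 1) (by omega)
        have := hcpos (n + 1) (by omega)
        simp only [Nat.add_sub_cancel] at h
        rw [hA (n + 1) (by omega), hF n hn]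
        refine lt_of_lt_of_eq h ?_
        field_simp
        ring
      have := quadratic_form_nonneg hlead hd (p (n + 2) x) (p (n + 1) x)
      have hG : 0 < a n * c n := mul_pos (hapos n hn) (hcpos n hn)
      have := mul_pos hG ih
      linarith
end

section
/- Let k ≥ 2. Suppose a_1 < a_2 < a_3 < ⋯ (the a_i strictly increasing) and a_{i−1}² − 3a_i² + 3a_{i+1}² − a_{i+2}² ≥ 0 for 1 ≤ i ≤ k−1. Then 3·p_k(x)² − 4·p_{k−1}(x)·p_{k+1}(x) + p_{k−2}(x)·p_{k+2}(x) > 0 for every real x. -/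
/-- Turán's inequality for symmetric orthogonal polynomials with increasing coefficients. -/
theorem turan_pos (b : ℕ → ℝ) (q : ℕ → ℝ) (x : ℝ) (hb0 : b 0 = 0)
    (hb : ∀ i, b i < b (i + 1)) (hq0 : q 0 = 0) (hq1 : q 1 = 1)
    (hrec : ∀ n, q (n + 2) = x * q (n + 1) - b n * q n) (n : ℕ) :
    0 < q (n + 1) ^ 2 - q n * q (n + 2) := by
  induction n with
  | zero => simp [hq0, hq1]
  | succ n ih =>
    have step : q (n + 2) ^ 2 - q (n + 1) * q (n + 3)
        = b n * (q (n + 1) ^ 2 - q n * q (n + 2)) + (b (n + 1) - b n) * q (n + 1) ^ 2 := by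
      linear_combination q (n + 2) * hrec n - q (n + 1) * hrec (n + 1)
    rw [step]
    have hd := sub_pos.2 (hb n)
    rcases n.eq_zero_or_pos with rfl | hn
    · simpa [hb0, hq1] using hd
    · have hb_pos : 0 < b n := hb0 ▸ strictMono_nat_of_lt_succ hb hn
      positivity

/-- The quartic Turán-type inequality, with coefficients whose third differences are
nonpositive up to the relevant index. -/
theorem quartic_turan_pos (b : ℕ → ℝ) (q : ℕ → ℝ) (x : ℝ) (hb0 : b 0 = 0)
    (hb : ∀ i, b i < b (i + 1)) (hq0 : q 0 = 0) (hq1 : q 1 = 1)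
    (hrec : ∀ n, q (n + 2) = x * q (n + 1) - b n * q n) (n : ℕ)
    (hdiff : ∀ i ≤ n, 0 ≤ b i - 3 * b (i + 1) + 3 * b (i + 2) - b (i + 3)) :
    0 < 3 * q (n + 3) ^ 2 - 4 * q (n + 2) * q (n + 4) + q (n + 1) * q (n + 5) := by
  have step (n : ℕ) : 3 * q (n + 3) ^ 2 - 4 * q (n + 2) * q (n + 4) + q (n + 1) * q (n + 5)
      = b n * (3 * q (n + 2) ^ 2 - 4 * q (n + 1) * q (n + 3) + q n * q (n + 4))
        + (b n - 3 * b (n + 1) + 3 * b (n + 2) - b (n + 3)) * q (n + 2) ^ 2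
        + (3 * b (n + 1) - 4 * b n + b (n + 3))
          * (q (n + 2) ^ 2 - q (n + 1) * q (n + 3)) := by
    linear_combination 3 * q (n + 3) * hrec (n + 1) - 3 * q (n + 2) * hrec (n + 2)
      + q (n + 1) * hrec (n + 3) - q (n + 4) * hrec n
  have hmono := strictMono_nat_of_lt_succ hb
  have hcoeff (n : ℕ) : 0 < 3 * b (n + 1) - 4 * b n + b (n + 3) := by
    linarith [hb n, hb (n + 1), hb (n + 2)]
  have hturan (n : ℕ) := turan_pos b q x hb0 hb hq0 hq1 hrec (n + 1)
  induction n with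
  | zero =>
    have hpos := add_pos_of_nonneg_of_pos
      (mul_nonneg (hdiff 0 le_rfl) (sq_nonneg (q 2))) (mul_pos (hcoeff 0) (hturan 0))
    rw [step]
    simpa only [hb0, zero_mul, zero_add] using hpos
  | succ n ih =>
    have hb_nonneg : 0 ≤ b (n + 1) := hb0 ▸ hmono.monotone (Nat.zero_le _)
    rw [step]
    exact add_pos_of_nonneg_of_pos
      (add_nonneg (mul_nonneg hb_nonneg (ih fun i hi => hdiff i (by omega)).le)
        (mul_nonneg (hdiff _ le_rfl) (sq_nonneg _)))
      (mul_pos (hcoeff _) (hturan _))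

/- Convention: `p n` denotes the paper's `p_{n-1}`, so `p 0 = p_{-1} = 0`, `p 1 = p_0 = 1`, and
the symmetric monic recurrence `p_i = x p_{i-1} - a_{i-1}² p_{i-2}` (for `i ≥ 1`) reads
`p (n+2) x = x * p (n+1) x - a n ^ 2 * p n x` for all `n ≥ 0`.
The conclusion is `T_4(p_k) = 3 p_k² - 4 p_{k-1} p_{k+1} + p_{k-2} p_{k+2} > 0`. -/
theorem stmt_4 (a : ℕ → ℝ) (p : ℕ → ℝ → ℝ) (k : ℕ) (hk : 2 ≤ k)
    (ha0 : a 0 = 0) (hapos : ∀ i, 1 ≤ i → 0 < a i)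
    (hp0 : ∀ x : ℝ, p 0 x = 0) (hp1 : ∀ x : ℝ, p 1 x = 1)
    (hrec : ∀ n, ∀ x : ℝ, p (n + 2) x = x * p (n + 1) x - a n ^ 2 * p n x)
    (hmono : ∀ i, 1 ≤ i → a i < a (i + 1))
    (hcond : ∀ i, 1 ≤ i → i ≤ k - 1 →
      a (i - 1) ^ 2 - 3 * a i ^ 2 + 3 * a (i + 1) ^ 2 - a (i + 2) ^ 2 ≥ 0) :
    ∀ x : ℝ, 3 * (p (k + 1) x) ^ 2 - 4 * p k x * p (k + 2) x
      + p (k - 1) x * p (k + 3) x > 0 := by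
  intro x
  obtain ⟨m, rfl⟩ := Nat.exists_eq_add_of_le' hk
  refine quartic_turan_pos (fun i => a i ^ 2) (fun n => p n x) x (by simp [ha0]) ?_ (hp0 x)
    (hp1 x) (fun n => hrec n x) m ?_
  · rintro (_ | i)
    · simpa [ha0] using pow_pos (hapos 1 le_rfl) 2
    · exact pow_lt_pow_left₀ (hmono _ (by omega)) (hapos _ (by omega)).le two_ne_zero
  · exact fun i hi => hcond (i + 1) (by omega) (by omega)
end

section
/- For every k ≥ 1 and every real x with b_k − 2a_k ≤ x ≤ b_k + 2a_k, one has p_k(x)² − (a_{k+1}/a_k)·p_{k−1}(x)·p_{k+1}(x) ≥ 0. -/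
/- Convention: `p n` denotes the paper's `p_{n-1}`, so `p 0 = p_{-1} = 0`, `p 1 = p_0 = 1`, and
the orthonormal recurrence `a_k p_k = (x - b_{k-1}) p_{k-1} - a_{k-1} p_{k-2}` (for `k ≥ 1`)
reads `a (n+1) * p (n+2) x = (x - b n) * p (n+1) x - a n * p n x` for all `n ≥ 0`. -/
theorem stmt_5 (a b : ℕ → ℝ) (p : ℕ → ℝ → ℝ)
    (ha0 : a 0 = 0) (hapos : ∀ k, 1 ≤ k → 0 < a k)
    (hp0 : ∀ x : ℝ, p 0 x = 0) (hp1 : ∀ x : ℝ, p 1 x = 1)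
    (hrec : ∀ n, ∀ x : ℝ,
      a (n + 1) * p (n + 2) x = (x - b n) * p (n + 1) x - a n * p n x) :
    ∀ k, 1 ≤ k → ∀ x : ℝ, b k - 2 * a k ≤ x → x ≤ b k + 2 * a k →
      (p (k + 1) x) ^ 2 - (a (k + 1) / a k) * p k x * p (k + 2) x ≥ 0 := by
  intro k hk x hl hu
  have ha := hapos k hk
  obtain ⟨t, ht⟩ : ∃ t, x - b k = t * a k := ⟨(x - b k) / a k, by field_simp⟩
  have h2 : t ≤ 2 := le_of_mul_le_mul_right (by linarith) ha
  have h3 : -2 ≤ t := le_of_mul_le_mul_right (by linarith) ha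
  have hr := hrec k x
  rw [ht] at hr
  have hexpr : (p (k + 1) x) ^ 2 - (a (k + 1) / a k) * p k x * p (k + 2) x
      = (p (k + 1) x - t / 2 * p k x) ^ 2 + (2 - t) * (2 + t) / 4 * (p k x) ^ 2 := by
    field_simp
    linear_combination (-16 * p k x) * hr
  have h4 : 0 ≤ (2 - t) * (2 + t) := mul_nonneg (by linarith) (by linarith)
  rw [hexpr]
  positivity
end

section
/- Suppose (a_k)_{k≥1} and (b_k)_{k≥0} are nondecreasing. Then for every k ≥ 1 and every real x ≥ b_k − 2a_k, one has p_k(x)² − (a_{k+1}/a_k)·p_{k−1}(x)·p_{k+1}(x) ≥ 0. -/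
/-- Above the oscillatory interval the solution of the recurrence is nonnegative and nondecreasing,
and the Turán form is nonnegative. -/
theorem turan_form_nonneg_of_large (a b q : ℕ → ℝ) (x : ℝ)
    (ha0 : a 0 = 0) (hapos : ∀ k, 1 ≤ k → 0 < a k)
    (hq1 : q 1 = 1)
    (hrec : ∀ n, a (n + 1) * q (n + 2) = (x - b n) * q (n + 1) - a n * q n)
    (hamono : ∀ k, 1 ≤ k → a k ≤ a (k + 1))
    (hbmono : ∀ k, b k ≤ b (k + 1)) (n : ℕ) (hx : b (n + 1) + 2 * a (n + 1) ≤ x) :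
    0 ≤ q (n + 1) ∧ q (n + 1) ≤ q (n + 2) ∧
      0 ≤ a (n + 1) * q (n + 2) ^ 2 - (x - b (n + 1)) * q (n + 1) * q (n + 2)
        + a (n + 1) * q (n + 1) ^ 2 := by
  induction n with
  | zero =>
    have hpos := hapos 1 le_rfl
    have hr := hrec 0
    have hb := hbmono 0
    simp only [zero_add, ha0, hq1, mul_one, zero_mul, sub_zero] at *
    have hle : 1 ≤ q 2 := by
      refine le_of_mul_le_mul_left ?_ hpos
      linarith
    refine ⟨zero_le_one, hle, ?_⟩
    have hmul : 0 ≤ (b 1 - b 0) * q 2 := mul_nonneg (by linarith) (by linarith)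
    have hform : a 1 * q 2 ^ 2 = (x - b 0) * q 2 := by rw [← hr]; ring
    linarith
  | succ n ih =>
    have hpos := hapos (n + 1) (by omega)
    have hpos' := hapos (n + 1 + 1) (by omega)
    have hr := hrec (n + 1)
    have hb := hbmono (n + 1)
    have ha := hamono (n + 1) (by omega)
    obtain ⟨hp, hpq, hform⟩ := ih (by linarith)
    simp only [add_assoc, Nat.reduceAdd] at *
    have hq : 0 ≤ q (n + 2) := hp.trans hpq
    have hle : q (n + 2) ≤ q (n + 3) := by
      refine le_of_mul_le_mul_left ?_ hpos'
      have h₁ : (a (n + 2) + a (n + 1)) * q (n + 2) ≤ (x - b (n + 1)) * q (n + 2) :=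
        mul_le_mul_of_nonneg_right (by linarith) hq
      have h₂ := mul_le_mul_of_nonneg_left hpq hpos.le
      linarith
    refine ⟨hq, hle, ?_⟩
    have hprev : q (n + 1) * (a (n + 2) * q (n + 3)) ≤ a (n + 1) * q (n + 2) ^ 2 := by
      rw [hr]; linarith
    have hcross : a (n + 1) * q (n + 1) * q (n + 3) ≤ a (n + 2) * q (n + 2) ^ 2 := by
      refine le_of_mul_le_mul_left ?_ hpos'
      have h₁ := mul_le_mul_of_nonneg_left hprev hpos.le
      have h₂ : a (n + 1) * a (n + 1) * q (n + 2) ^ 2 ≤ a (n + 2) * a (n + 2) * q (n + 2) ^ 2 :=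
        mul_le_mul_of_nonneg_right (mul_self_le_mul_self hpos.le ha) (sq_nonneg _)
      linarith
    have hshift : 0 ≤ (b (n + 2) - b (n + 1)) * (q (n + 2) * q (n + 3)) :=
      mul_nonneg (by linarith) (mul_nonneg hq (hq.trans hle))
    have hsq : a (n + 2) * q (n + 3) ^ 2
        = ((x - b (n + 1)) * q (n + 2) - a (n + 1) * q (n + 1)) * q (n + 3) := by
      rw [← hr]; ring
    linarith

/- Convention: `p n` denotes the paper's `p_{n-1}`, so `p 0 = p_{-1} = 0`, `p 1 = p_0 = 1`, and
the orthonormal recurrence reads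
`a (n+1) * p (n+2) x = (x - b n) * p (n+1) x - a n * p n x` for all `n ≥ 0`. -/
theorem stmt_6 (a b : ℕ → ℝ) (p : ℕ → ℝ → ℝ)
    (ha0 : a 0 = 0) (hapos : ∀ k, 1 ≤ k → 0 < a k)
    (hp0 : ∀ x : ℝ, p 0 x = 0) (hp1 : ∀ x : ℝ, p 1 x = 1)
    (hrec : ∀ n, ∀ x : ℝ,
      a (n + 1) * p (n + 2) x = (x - b n) * p (n + 1) x - a n * p n x)
    (hamono : ∀ k, 1 ≤ k → a k ≤ a (k + 1))
    (hbmono : ∀ k, b k ≤ b (k + 1)) :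
    ∀ k, 1 ≤ k → ∀ x : ℝ, b k - 2 * a k ≤ x →
      (p (k + 1) x) ^ 2 - (a (k + 1) / a k) * p k x * p (k + 2) x ≥ 0 := by
  intro k hk x hx
  have hpos := hapos k hk
  have hform : 0 ≤ a k * p (k + 1) x ^ 2 - (x - b k) * p k x * p (k + 1) x
      + a k * p k x ^ 2 := by
    rcases le_total (b k + 2 * a k) x with h | h
    · obtain ⟨n, rfl⟩ : ∃ n, k = n + 1 := ⟨k - 1, by omega⟩
      exact (turan_form_nonneg_of_large a b (fun n => p n x) x ha0 hapos (hp1 x)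
        (fun n => hrec n x) hamono hbmono n h).2.2
    · have h₁ := mul_nonneg (sub_nonneg.2 hx) (sq_nonneg (p (k + 1) x - p k x))
      have h₂ := mul_nonneg (sub_nonneg.2 h) (sq_nonneg (p (k + 1) x + p k x))
      linarith
  have hEq : p (k + 1) x ^ 2 - a (k + 1) / a k * p k x * p (k + 2) x
      = (a k * p (k + 1) x ^ 2 - (x - b k) * p k x * p (k + 1) x + a k * p k x ^ 2) / a k := by
    have hr := hrec k x
    field_simp
    linear_combination (-p k x) * hr
  rw [hEq]
  exact div_nonneg hform hpos.le
end

section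
/- Suppose a_1 < a_2 < a_3 < ⋯ (the a_k strictly increasing). Then for every k ≥ 1 and every real x, p_k(x)² − (a_{k+1}/a_k)·p_{k−1}(x)·p_{k+1}(x) > 0. -/
/- Convention: `p n` denotes the paper's `p_{n-1}`, so `p 0 = p_{-1} = 0`, `p 1 = p_0 = 1`, and
the symmetric orthonormal recurrence `a_k p_k = x p_{k-1} - a_{k-1} p_{k-2}` (for `k ≥ 1`)
reads `a (n+1) * p (n+2) x = x * p (n+1) x - a n * p n x` for all `n ≥ 0`. -/
theorem stmt_7 (a : ℕ → ℝ) (p : ℕ → ℝ → ℝ)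
    (ha0 : a 0 = 0) (hapos : ∀ k, 1 ≤ k → 0 < a k)
    (hp0 : ∀ x : ℝ, p 0 x = 0) (hp1 : ∀ x : ℝ, p 1 x = 1)
    (hrec : ∀ n, ∀ x : ℝ, a (n + 1) * p (n + 2) x = x * p (n + 1) x - a n * p n x)
    (hmono : ∀ k, 1 ≤ k → a k < a (k + 1)) :
    ∀ k, 1 ≤ k → ∀ x : ℝ,
      (p (k + 1) x) ^ 2 - (a (k + 1) / a k) * p k x * p (k + 2) x > 0 := by
  have key : ∀ k, 1 ≤ k → ∀ x : ℝ,
      0 < a k * (p (k + 1) x ^ 2 + p k x ^ 2) - x * p k x * p (k + 1) x := by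
    intro k hk x
    induction k, hk using Nat.le_induction with
    | base =>
      have h1 := hapos 1 le_rfl
      have h := hrec 0 x
      simp only [zero_add, ha0, hp0, hp1] at h ⊢
      have h2 : a 1 * (p (1 + 1) x ^ 2 + 1 ^ 2) - x * 1 * p (1 + 1) x = a 1 := by
        linear_combination p 2 x * h
      rw [h2]
      exact h1
    | succ k hk ih =>
      have h0 := hapos k hk
      have h1 := hapos (k + 1) (by omega)
      have hm := hmono k hk
      have h := hrec k x
      have hid : a (k + 1) * (a (k + 1) * (p (k + 1 + 1) x ^ 2 + p (k + 1) x ^ 2)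
            - x * p (k + 1) x * p (k + 1 + 1) x)
          = a k * (a k * (p (k + 1) x ^ 2 + p k x ^ 2) - x * p k x * p (k + 1) x)
            + (a (k + 1) ^ 2 - a k ^ 2) * p (k + 1) x ^ 2 := by
        linear_combination (a (k + 1) * p (k + 2) x - a k * p k x) * h
      have hsq : 0 ≤ a (k + 1) ^ 2 - a k ^ 2 := by nlinarith
      refine pos_of_mul_pos_right (a := a (k + 1)) ?_ h1.le
      rw [hid]
      positivity
  intro k hk x
  have h0 := hapos k hk
  have h : p (k + 1) x ^ 2 - a (k + 1) / a k * p k x * p (k + 2) x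
      = (a k * (p (k + 1) x ^ 2 + p k x ^ 2) - x * p k x * p (k + 1) x) / a k := by
    field_simp
    linear_combination -p k x * hrec k x
  rw [h]
  exact div_pos (key k hk x) h0
end

section
/- Suppose a_1 < a_2 < a_3 < ⋯ (the a_k strictly increasing) and R_i ≥ 0 for every i with 3 ≤ i ≤ k, where k ≥ 2. Then S_4(p_k)(x) > 0 for every real x. -/
/-- Turán's inequality for the monic orthogonal polynomials with increasing recurrence
coefficients. -/
theorem monic_turan_pos {c P : ℕ → ℝ} {x : ℝ} (hc1 : 0 < c 1)
    (hmono : ∀ n, c (n + 1) < c (n + 2)) (h0 : P 0 = 1) (h1 : P 1 = x)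
    (hrec : ∀ n, P (n + 2) = x * P (n + 1) - c (n + 1) * P n) (n : ℕ) :
    0 < P (n + 1) ^ 2 - P n * P (n + 2) := by
  induction n with
  | zero =>
    have h : P (0 + 1) ^ 2 - P 0 * P (0 + 2) = c 1 := by
      rw [hrec 0, zero_add, h0, h1]; ring
    rwa [h]
  | succ n ih =>
    have hpos : 0 < c (n + 1) := hc1.trans_le (monotone_nat_of_le_succ
      (f := fun n => c (n + 1)) (fun n => (hmono n).le) (Nat.zero_le n))
    have h : P (n + 2) ^ 2 - P (n + 1) * P (n + 3)
        = c (n + 1) * (P (n + 1) ^ 2 - P n * P (n + 2))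
          + (c (n + 2) - c (n + 1)) * P (n + 1) ^ 2 := by
      rw [hrec (n + 1), hrec n]; ring
    change 0 < P (n + 2) ^ 2 - P (n + 1) * P (n + 3)
    rw [h]
    have := mul_pos hpos ih
    have := mul_nonneg (sub_nonneg.2 (hmono n).le) (sq_nonneg (P (n + 1)))
    linarith

/-- The higher order Turán inequality for monic orthogonal polynomials, cleared of
denominators. -/
theorem monic_higher_turan_pos {c P : ℕ → ℝ} {x : ℝ} (hc0 : c 0 = 0) (hc1 : 0 < c 1)
    (hmono : ∀ n, c (n + 1) < c (n + 2)) (h0 : P 0 = 1) (h1 : P 1 = x)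
    (hrec : ∀ n, P (n + 2) = x * P (n + 1) - c (n + 1) * P n) (m : ℕ)
    (hR : ∀ i < m, 0 ≤ c (i + 4) * c (i + 3) * (c (i + 2) - c (i + 1))
      - c (i + 3) * c (i + 1) * (c (i + 3) - c (i + 1))
      + c (i + 1) * c i * (c (i + 3) - c (i + 2))) :
    0 < (c (m + 3) - c m) * P (m + 2) ^ 2
      - (c (m + 3) + c (m + 2) - c (m + 1) - c m) * (P (m + 1) * P (m + 3))
      + (c (m + 2) - c (m + 1)) * (P m * P (m + 4)) := by
  have hpos (n : ℕ) : 0 < c (n + 1) := hc1.trans_le (monotone_nat_of_le_succ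
    (f := fun n => c (n + 1)) (fun n => (hmono n).le) (Nat.zero_le n))
  induction m with
  | zero =>
    have h : (c (0 + 3) - c 0) * P (0 + 2) ^ 2
        - (c (0 + 3) + c (0 + 2) - c (0 + 1) - c 0) * (P (0 + 1) * P (0 + 3))
        + (c (0 + 2) - c (0 + 1)) * (P 0 * P (0 + 4)) = c 3 * c 2 * c 1 := by
      rw [hrec (0 + 2), hrec (0 + 1), hrec 0]
      simp only [zero_add, Nat.reduceAdd, h0, h1, hc0]
      ring
    rw [h]
    exact mul_pos (mul_pos (hpos 2) (hpos 1)) (hpos 0)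
  | succ m ih =>
    have ih := ih fun i hi => hR i (hi.trans m.lt_succ_self)
    have hT := monic_turan_pos hc1 hmono h0 h1 hrec (m + 1)
    refine pos_of_mul_pos_right (a := c (m + 2) - c (m + 1)) ?_ (sub_pos.2 (hmono m)).le
    have key := add_pos_of_pos_of_nonneg
      (mul_pos (mul_pos (sub_pos.2 (hmono (m + 1))) (hpos m)) ih)
      (mul_nonneg (hR m m.lt_succ_self) hT.le)
    refine key.trans_eq ?_
    change _ = (c (m + 2) - c (m + 1)) * ((c (m + 4) - c (m + 1)) * P (m + 3) ^ 2
      - (c (m + 4) + c (m + 3) - c (m + 2) - c (m + 1)) * (P (m + 2) * P (m + 4))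
      + (c (m + 3) - c (m + 2)) * (P (m + 1) * P (m + 5)))
    rw [hrec (m + 3), hrec (m + 2), hrec (m + 1), hrec m]
    ring


/- Convention: `p n` denotes the paper's `p_{n-1}`, so `p 0 = p_{-1} = 0`, `p 1 = p_0 = 1`, and
the symmetric orthonormal recurrence reads
`a (n+1) * p (n+2) x = x * p (n+1) x - a n * p n x` for all `n ≥ 0`.
The conclusion is `S_4(p_k) > 0` written out explicitly (the paper's `p_k` is `p (k+1)` here). -/
theorem stmt_8 (a : ℕ → ℝ) (p : ℕ → ℝ → ℝ) (k : ℕ) (hk : 2 ≤ k)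
    (ha0 : a 0 = 0) (hapos : ∀ i, 1 ≤ i → 0 < a i)
    (hp0 : ∀ x : ℝ, p 0 x = 0) (hp1 : ∀ x : ℝ, p 1 x = 1)
    (hrec : ∀ n, ∀ x : ℝ, a (n + 1) * p (n + 2) x = x * p (n + 1) x - a n * p n x)
    (hmono : ∀ i, 1 ≤ i → a i < a (i + 1))
    (hR : ∀ i, 3 ≤ i → i ≤ k →
      a (i + 1) ^ 2 * a i ^ 2 * (a (i - 1) ^ 2 - a (i - 2) ^ 2)
        - a i ^ 2 * a (i - 2) ^ 2 * (a i ^ 2 - a (i - 2) ^ 2)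
        + a (i - 2) ^ 2 * a (i - 3) ^ 2 * (a i ^ 2 - a (i - 1) ^ 2) ≥ 0) :
    ∀ x : ℝ, (p (k + 1) x) ^ 2
      - (a (k + 1) * (a (k + 1) ^ 2 + a k ^ 2 - a (k - 1) ^ 2 - a (k - 2) ^ 2) /
          (a k * (a (k + 1) ^ 2 - a (k - 2) ^ 2))) * p k x * p (k + 2) x
      + (a (k + 2) * a (k + 1) * (a k ^ 2 - a (k - 1) ^ 2) /
          (a k * a (k - 1) * (a (k + 1) ^ 2 - a (k - 2) ^ 2))) * p (k - 1) x * p (k + 3) x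
      > 0 := by
  intro x
  obtain ⟨m, rfl⟩ := Nat.exists_eq_add_of_le' hk
  have hpos (n : ℕ) : 0 < a (n + 1) := hapos _ n.succ_pos
  have hlt (n : ℕ) : a (n + 1) ^ 2 < a (n + 2) ^ 2 :=
    pow_lt_pow_left₀ (hmono (n + 1) n.succ_pos) (hpos n).le two_ne_zero
  set s : ℕ → ℝ := fun n => ∏ i ∈ Finset.range n, a (i + 1) with hs
  have hs_succ (n : ℕ) : s (n + 1) = s n * a (n + 1) := Finset.prod_range_succ _ n
  have hs_pos (n : ℕ) : 0 < s n := Finset.prod_pos fun i _ => hpos i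
  have hD : 0 < a (m + 3) ^ 2 - a m ^ 2 := by
    have h : a m ^ 2 < a (m + 1) ^ 2 := by
      cases m with
      | zero => rw [ha0]; have := pow_pos (hpos 0) 2; simpa using this
      | succ m => exact hlt m
    linarith [hlt m, hlt (m + 1)]
  have key := monic_higher_turan_pos (c := fun n => a n ^ 2) (P := fun n => s n * p (n + 1) x)
    (x := x) (by simp [ha0]) (pow_pos (hpos 0) 2) hlt (by simp [hs, hp1])
    (by
      have h := hrec 0 x
      rw [hp0, hp1, zero_add] at h
      simp only [hs, Finset.prod_range_one, zero_add, Nat.reduceAdd]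
      linarith)
    (fun n => by
      have h := hrec (n + 1) x
      simp only [hs_succ]
      linear_combination s n * a (n + 1) * h)
    m (fun i hi => hR (i + 3) (by omega) (by omega))
  simp only [hs_succ] at key
  change 0 < (p (m + 3) x) ^ 2
      - (a (m + 3) * (a (m + 3) ^ 2 + a (m + 2) ^ 2 - a (m + 1) ^ 2 - a m ^ 2) /
          (a (m + 2) * (a (m + 3) ^ 2 - a m ^ 2))) * p (m + 2) x * p (m + 4) x
      + (a (m + 4) * a (m + 3) * (a (m + 2) ^ 2 - a (m + 1) ^ 2) /
          (a (m + 2) * a (m + 1) * (a (m + 3) ^ 2 - a m ^ 2))) * p (m + 1) x * p (m + 5) x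
  have h1 := hpos m
  have h2 := hpos (m + 1)
  have h3 := hs_pos m
  refine pos_of_mul_pos_right (a := (a (m + 3) ^ 2 - a m ^ 2)
    * (s m * a (m + 1) * a (m + 2)) ^ 2) (key.trans_eq ?_) (by positivity)
  have h1' := h1.ne'
  have h2' : a (m + 2) ≠ 0 := h2.ne'
  have hD' := hD.ne'
  field_simp
end

section
/- Let k ≥ 3 and let a_0, a_1, …, a_{k+1} be real numbers with a_0 = 0 and a_i > 0 for 1 ≤ i ≤ k+1. Assume: (i) a_1 < a_2 < ⋯ < a_{k+1}; (ii) a_{i+1}² − 2a_i² + a_{i−1}² ≥ 0 for 1 ≤ i ≤ k; (iii) the ratios a_i/a_{i+1} are nondecreasing in i, i.e., a_i·a_{i+2} ≤ a_{i+1}² for 0 ≤ i ≤ k−1. Then R_k > 0, where R_k = a_{k+1}²·a_k²·(a_{k−1}² − a_{k−2}²) − a_k²·a_{k−2}²·(a_k² − a_{k−2}²) + a_{k−2}²·a_{k−3}²·(a_k² − a_{k−1}²). -/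
/-- If `p, q, r, s, t` satisfy `q < r < s`, are convex at `q` and at `s`, and log-concave at `r`,
then the associated cubic expression is positive. -/
theorem cubic_pos_of_convex_of_logConcave {p q r s t : ℝ} (hq : 0 < q) (hqr : q < r) (hrs : r < s)
    (hcq : 0 ≤ r - 2 * q + p) (hcs : 0 ≤ t - 2 * s + r) (hlog : q * s ≤ r ^ 2) :
    0 < t * s * (r - q) - s * q * (s - q) + q * p * (s - r) := by
  have hu : 0 < r - q := sub_pos.2 hqr
  have hv : 0 < s - r := sub_pos.2 hrs
  have hs : 0 < s := hq.trans (hqr.trans hrs)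
  have ht : 0 ≤ s * (r - q) * (t - 2 * s + r) := by positivity
  have hp : 0 ≤ q * (s - r) * (r - 2 * q + p) := by positivity
  have hl : 0 ≤ (s - q) * (r ^ 2 - q * s) :=
    mul_nonneg (by linarith) (sub_nonneg.2 hlog)
  have hpos : 0 < 2 * (r - q) * (s - r) * ((r - q) + (s - r)) := by positivity
  linear_combination ht + hp + hl + hpos


theorem stmt_9 (k : ℕ) (hk : 3 ≤ k) (a : ℕ → ℝ)
    (ha0 : a 0 = 0) (hapos : ∀ i, 1 ≤ i → i ≤ k + 1 → 0 < a i)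
    (hmono : ∀ i, 1 ≤ i → i ≤ k → a i < a (i + 1))
    (hconvex : ∀ i, 1 ≤ i → i ≤ k → a (i + 1) ^ 2 - 2 * a i ^ 2 + a (i - 1) ^ 2 ≥ 0)
    (hratio : ∀ i, i ≤ k - 1 → a i * a (i + 2) ≤ a (i + 1) ^ 2) :
    a (k + 1) ^ 2 * a k ^ 2 * (a (k - 1) ^ 2 - a (k - 2) ^ 2)
      - a k ^ 2 * a (k - 2) ^ 2 * (a k ^ 2 - a (k - 2) ^ 2)
      + a (k - 2) ^ 2 * a (k - 3) ^ 2 * (a k ^ 2 - a (k - 1) ^ 2) > 0 := by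
  obtain ⟨m, rfl⟩ : ∃ m, k = m + 3 := ⟨k - 3, by omega⟩
  have hq := hapos (m + 1) (by omega) (by omega)
  have hr := hapos (m + 2) (by omega) (by omega)
  have hqr := hmono (m + 1) (by omega) (by omega)
  have hrs := hmono (m + 2) (by omega) (by omega)
  have hs := hapos (m + 3) (by omega) (by omega)
  have hlog : a (m + 1) ^ 2 * a (m + 3) ^ 2 ≤ (a (m + 2) ^ 2) ^ 2 := by
    rw [← mul_pow]
    exact pow_le_pow_left₀ (mul_pos hq hs).le (hratio (m + 1) (by omega)) 2
  exact cubic_pos_of_convex_of_logConcave (pow_pos hq 2)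
    (pow_lt_pow_left₀ hqr hq.le two_ne_zero) (pow_lt_pow_left₀ hrs hr.le two_ne_zero)
    (hconvex (m + 1) (by omega) (by omega)) (hconvex (m + 3) (by omega) (by omega)) hlog
end

section
/- Let (a_k)_{k≥0} be given with a_0 = 0 and a_k > 0 for k ≥ 1. Then for every k ≥ 1 the following identities hold in ℝ[x]: (1) for the symmetric monic polynomials p_k, p_k² − p_{k−1}·p_{k+1} = Σ_{i=0}^{k−1} (a_{i+1}² − a_i²)·p_i²·∏_{j=i+1}^{k−1} a_j²; (2) for the symmetric orthonormal polynomials 𝐩_k, 𝐩_k² − (a_{k+1}/a_k)·𝐩_{k−1}·𝐩_{k+1} = a_k^{−2}·Σ_{i=0}^{k−1} (a_{i+1}² − a_i²)·𝐩_i². -/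
theorem sq_sub_mul_eq_sum_of_monic_recurrence {R : Type*} [CommRing R] (x : R) (a p : ℕ → R)
    (ha0 : a 0 = 0) (hp0 : p 0 = 0) (hp1 : p 1 = 1)
    (hrec : ∀ n, p (n + 2) = x * p (n + 1) - a n ^ 2 * p n) (k : ℕ) :
    p (k + 2) ^ 2 - p (k + 1) * p (k + 3) =
      ∑ i ∈ Finset.range (k + 1), (a (i + 1) ^ 2 - a i ^ 2) * p (i + 1) ^ 2 *
        ∏ j ∈ Finset.Icc (i + 1) k, a j ^ 2 := by
  induction k with
  | zero =>
    have h2 := hrec 0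
    have h3 := hrec 1
    simp only [zero_add, Nat.reduceAdd, hp0, hp1, mul_one, mul_zero, sub_zero] at h2 h3
    simp [h2, h3, ha0, hp1]
    ring
  | succ k ih =>
    have hprod : ∀ i ∈ Finset.range (k + 1),
        (a (i + 1) ^ 2 - a i ^ 2) * p (i + 1) ^ 2 * ∏ j ∈ Finset.Icc (i + 1) (k + 1), a j ^ 2 =
          (a (i + 1) ^ 2 - a i ^ 2) * p (i + 1) ^ 2 *
            (∏ j ∈ Finset.Icc (i + 1) k, a j ^ 2) * a (k + 1) ^ 2 := by
      intro i hi
      rw [Finset.prod_Icc_succ_top (by have := Finset.mem_range.1 hi; lia),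
        mul_assoc _ _ (a (k + 1) ^ 2)]
    rw [Finset.sum_range_succ, Finset.sum_congr rfl hprod, ← Finset.sum_mul, ← ih,
      Finset.Icc_eq_empty (by lia), Finset.prod_empty]
    linear_combination p (k + 3) * hrec (k + 1) - p (k + 2) * hrec (k + 2)

theorem sq_sub_mul_eq_sum_of_orthonormal_recurrence {R : Type*} [CommRing R] (x : R)
    (a q : ℕ → R) (ha0 : a 0 = 0)
    (hrec : ∀ n, a (n + 1) * q (n + 2) = x * q (n + 1) - a n * q n) (k : ℕ) :
    a k ^ 2 * q (k + 1) ^ 2 - a k * a (k + 1) * q k * q (k + 2) =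
      ∑ i ∈ Finset.range k, (a (i + 1) ^ 2 - a i ^ 2) * q (i + 1) ^ 2 := by
  induction k with
  | zero => simp [ha0]
  | succ k ih =>
    rw [Finset.sum_range_succ, ← ih]
    linear_combination a (k + 1) * q (k + 2) * hrec k - a (k + 1) * q (k + 1) * hrec (k + 1)

/- Convention: `p n` (monic) and `q n` (orthonormal, the paper's `𝐩`) denote the paper's
`p_{n-1}` and `𝐩_{n-1}`: `p 0 = 0`, `p 1 = 1`, `p (n+2) x = x * p (n+1) x - a n ^ 2 * p n x`,
and `q 0 = 0`, `q 1 = 1`, `a (n+1) * q (n+2) x = x * q (n+1) x - a n * q n x`. -/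
theorem stmt_10 (a : ℕ → ℝ) (p q : ℕ → ℝ → ℝ)
    (ha0 : a 0 = 0) (hapos : ∀ k, 1 ≤ k → 0 < a k)
    (hp0 : ∀ x : ℝ, p 0 x = 0) (hp1 : ∀ x : ℝ, p 1 x = 1)
    (hprec : ∀ n, ∀ x : ℝ, p (n + 2) x = x * p (n + 1) x - a n ^ 2 * p n x)
    (hq0 : ∀ x : ℝ, q 0 x = 0) (hq1 : ∀ x : ℝ, q 1 x = 1)
    (hqrec : ∀ n, ∀ x : ℝ, a (n + 1) * q (n + 2) x = x * q (n + 1) x - a n * q n x) :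
    ∀ k, 1 ≤ k → ∀ x : ℝ,
      ((p (k + 1) x) ^ 2 - p k x * p (k + 2) x =
        ∑ i ∈ Finset.range k, (a (i + 1) ^ 2 - a i ^ 2) * (p (i + 1) x) ^ 2 *
          ∏ j ∈ Finset.Icc (i + 1) (k - 1), a j ^ 2) ∧
      ((q (k + 1) x) ^ 2 - (a (k + 1) / a k) * q k x * q (k + 2) x =
        (a k ^ 2)⁻¹ * ∑ i ∈ Finset.range k, (a (i + 1) ^ 2 - a i ^ 2) * (q (i + 1) x) ^ 2) := by
  intro k hk x
  constructor
  · obtain ⟨m, rfl⟩ := Nat.exists_eq_add_of_le' hk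
    exact sq_sub_mul_eq_sum_of_monic_recurrence x a (fun n => p n x) ha0 (hp0 x) (hp1 x)
      (fun n => hprec n x) m
  · have hak : a k ≠ 0 := (hapos k hk).ne'
    rw [← sq_sub_mul_eq_sum_of_orthonormal_recurrence x a (fun n => q n x) ha0
      (fun n => hqrec n x) k]
    field_simp
end

section
/- Suppose b_1 ≥ b_0 and a_2 ≥ (4/3)·a_1. Then 3·p_1(x)² − 4·p_2(x) ≥ 0 for every real x ≥ b_1 (this is the inequality T_4(p_1) = 3p_1² − 4p_0·p_2 + p_{−1}·p_3 ≥ 0 on [b_1, ∞), since p_{−1} = 0 and p_0 = 1). -/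
/- Convention: `p n` denotes the paper's `p_{n-1}`, so `p 0 = 0`, `p 1 = 1`, and the
orthonormal recurrence reads `a (n+1) * p (n+2) x = (x - b n) * p (n+1) x - a n * p n x`.
The conclusion is `T_4(p_1) = 3 p_1² - 4 p_0 p_2 + p_{-1} p_3 = 3 p_1² - 4 p_2 ≥ 0` on
`[b 1, ∞)`; here the paper's `p_1` is `p 2` and the paper's `p_2` is `p 3`. -/
theorem stmt_13 (a b : ℕ → ℝ) (p : ℕ → ℝ → ℝ)
    (ha0 : a 0 = 0) (hapos : ∀ k, 1 ≤ k → 0 < a k)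
    (hp0 : ∀ x : ℝ, p 0 x = 0) (hp1 : ∀ x : ℝ, p 1 x = 1)
    (hrec : ∀ n, ∀ x : ℝ,
      a (n + 1) * p (n + 2) x = (x - b n) * p (n + 1) x - a n * p n x)
    (hb : b 1 ≥ b 0) (ha : a 2 ≥ (4 / 3) * a 1) :
    ∀ x : ℝ, x ≥ b 1 → 3 * (p 2 x) ^ 2 - 4 * p 3 x ≥ 0 := by
  intro x hx
  have h₁ : 0 < a 1 := hapos 1 le_rfl
  have h₂ : 0 < a 2 := hapos 2 one_le_two
  have e₀ : a 1 * p 2 x = x - b 0 := by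
    simpa [hp0, hp1] using hrec 0 x
  have e₁ : a 2 * p 3 x = (x - b 1) * p 2 x - a 1 := by
    simpa [hp1] using hrec 1 x
  have hq : 0 ≤ p 2 x := nonneg_of_mul_nonneg_right (by linarith) h₁
  have hle : (x - b 1) * p 2 x ≤ a 1 * p 2 x * p 2 x :=
    mul_le_mul_of_nonneg_right (by linarith) hq
  have hsq : 4 / 3 * a 1 * p 2 x ^ 2 ≤ a 2 * p 2 x ^ 2 :=
    mul_le_mul_of_nonneg_right ha (sq_nonneg _)
  exact nonneg_of_mul_nonneg_right (a := a 2) (by linarith) h₂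
end

section
/- For every i ≥ 2 one has: (1) 3·α_{i+1}·α_{i+2} − 4·α_i·α_{i+2} + α_{i−1}·α_i ≥ 0; (2) (α_i − α_{i−1} + β_i − β_{i−1})·(β_{i+1} − β_{i−2}) + (α_i − α_{i−1})·(4α_{i+2} − α_{i−1}) − α_{i+1}·(α_{i+1} − α_{i−2}) ≥ (α_i − α_{i−1} + β_i − β_{i−1})·(β_{i+1} − β_{i−2}) ≥ 0. -/
theorem two_mul_rpow_le_add_rpow {r x : ℝ} (hr : 1 ≤ r) (hx : 0 ≤ x) :
    2 * (x + 1) ^ r ≤ x ^ r + (x + 2) ^ r := by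
  have h := (convexOn_rpow hr).2 (Set.mem_Ici.2 hx) (Set.mem_Ici.2 (by linarith : 0 ≤ x + 2))
    (by norm_num : (0 : ℝ) ≤ 1 / 2) (by norm_num : (0 : ℝ) ≤ 1 / 2) (by norm_num)
  simp only [smul_eq_mul] at h
  rw [show 1 / 2 * x + 1 / 2 * (x + 2) = x + 1 by ring] at h
  linarith

theorem rpow_mul_rpow_le_sq_rpow {r x : ℝ} (hr : 0 ≤ r) (hx : 0 ≤ x) :
    x ^ r * (x + 2) ^ r ≤ ((x + 1) ^ r) ^ 2 := by
  rw [sq, ← Real.mul_rpow hx (by linarith), ← Real.mul_rpow (by linarith) (by linarith)]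
  exact Real.rpow_le_rpow (by positivity) (by nlinarith) hr

/-- A weighted power-mean inequality for four consecutive powers. -/
theorem four_mul_rpow_le {r x : ℝ} (hr : 1 ≤ r) (hx : 0 ≤ x) :
    4 * (x + 1) ^ r * (x + 3) ^ r
      ≤ 3 * (x + 2) ^ r * (x + 3) ^ r + x ^ r * (x + 1) ^ r := by
  have hu : 0 ≤ (x + 2) * (x + 3) := by positivity
  have hw : 0 ≤ x * (x + 1) := by positivity
  have h := (convexOn_rpow hr).2 (Set.mem_Ici.2 hu) (Set.mem_Ici.2 hw)
    (by norm_num : (0 : ℝ) ≤ 3 / 4) (by norm_num : (0 : ℝ) ≤ 1 / 4) (by norm_num)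
  simp only [smul_eq_mul] at h
  have hle : ((x + 1) * (x + 3)) ^ r
      ≤ (3 / 4 * ((x + 2) * (x + 3)) + 1 / 4 * (x * (x + 1))) ^ r :=
    Real.rpow_le_rpow (by positivity) (by nlinarith) (by linarith)
  have h' := hle.trans h
  rw [Real.mul_rpow (by positivity) (by positivity), Real.mul_rpow (by positivity) (by positivity),
    Real.mul_rpow (by positivity) (by positivity)] at h'
  linarith

/-- The key inequality for five consecutive terms of a convex sequence that is log-concave and
grows by a factor at most `3 / 2` in the middle. -/
theorem mul_sub_le_of_convex_of_logConcave {p₀ p₁ p₂ p₃ p₄ : ℝ} (hp₁ : 0 < p₁) (h₁₂ : p₁ ≤ p₂)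
    (hc₁ : 2 * p₁ ≤ p₀ + p₂) (hc₂ : 2 * p₂ ≤ p₁ + p₃) (hc₃ : 2 * p₃ ≤ p₂ + p₄)
    (hlog : p₁ * p₃ ≤ p₂ ^ 2) (hratio : p₂ ≤ 3 / 2 * p₁) :
    p₃ * (p₃ - p₀) ≤ (p₂ - p₁) * (4 * p₄ - p₁) := by
  have hp₃ : p₃ ≤ 9 / 4 * p₁ := by
    have : p₁ * p₃ ≤ p₁ * (9 / 4 * p₁) := by nlinarith
    exact le_of_mul_le_mul_left this hp₁
  have hD : 0 ≤ p₂ - p₁ := by linarith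
  have hsecond : p₃ * (p₃ - 2 * p₂ + p₁) ≤ 9 / 4 * (p₂ - p₁) ^ 2 := by
    have : p₃ * (p₃ - 2 * p₂ + p₁) ≤ 9 / 4 * p₁ * (p₃ - 2 * p₂ + p₁) :=
      mul_le_mul_of_nonneg_right hp₃ (by linarith)
    nlinarith
  have hfirst : p₃ * (p₃ - p₀) ≤ p₃ * (3 * (p₂ - p₁) + (p₃ - 2 * p₂ + p₁)) :=
    mul_le_mul_of_nonneg_left (by linarith) (by linarith)
  have hlast : (p₂ - p₁) * (3 * p₃ + 6 * (p₂ - p₁)) ≤ (p₂ - p₁) * (4 * p₄ - p₁) :=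
    mul_le_mul_of_nonneg_left (by linarith) hD
  nlinarith [sq_nonneg (p₂ - p₁)]

/- Test sequences: `m = 1/((3/2)^(1/r) - 1) - 2`, `α 0 = 0`, `α 1 = (m+2)^r / 2`,
`α i = (i+m)^r` for `i ≥ 2`, and `β i = γ (i+m)^s`, with real powers. -/
theorem stmt_14 (r s γ m : ℝ) (α β : ℕ → ℝ)
    (hr : 1 ≤ r) (hs0 : 0 ≤ s) (hs1 : s ≤ r + 1) (hγ : 0 ≤ γ)
    (hm : m = 1 / ((3 / 2 : ℝ) ^ (1 / r) - 1) - 2)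
    (hα0 : α 0 = 0) (hα1 : α 1 = (m + 2) ^ r / 2)
    (hα : ∀ i, 2 ≤ i → α i = ((i : ℝ) + m) ^ r)
    (hβ : ∀ i, β i = γ * ((i : ℝ) + m) ^ s) :
    ∀ i, 2 ≤ i →
      (3 * α (i + 1) * α (i + 2) - 4 * α i * α (i + 2) + α (i - 1) * α i ≥ 0) ∧
      ((α i - α (i - 1) + β i - β (i - 1)) * (β (i + 1) - β (i - 2))
          + (α i - α (i - 1)) * (4 * α (i + 2) - α (i - 1))
          - α (i + 1) * (α (i + 1) - α (i - 2))
        ≥ (α i - α (i - 1) + β i - β (i - 1)) * (β (i + 1) - β (i - 2))) ∧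
      ((α i - α (i - 1) + β i - β (i - 1)) * (β (i + 1) - β (i - 2)) ≥ 0) := by
  have hr0 : 0 < r := by linarith
  obtain ⟨c, hc⟩ : ∃ c : ℝ, c = (3 / 2 : ℝ) ^ (1 / r) := ⟨_, rfl⟩
  have hc1 : 1 < c := hc ▸ Real.one_lt_rpow (by norm_num) (by positivity)
  have hc2 : c ≤ 3 / 2 := by
    rw [hc]
    exact Real.rpow_le_self_of_one_le (by norm_num) (by rw [div_le_one hr0]; exact hr)
  have hcr : c ^ r = 3 / 2 := by
    rw [hc, ← Real.rpow_mul (by norm_num), one_div_mul_cancel hr0.ne', Real.rpow_one]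
  have hmc : (m + 2) * (c - 1) = 1 := by
    rw [hm, ← hc]
    have : c - 1 ≠ 0 := by linarith
    field_simp
    ring
  have hm0 : 0 ≤ m := by
    by_contra! h
    nlinarith
  have hα' (n : ℕ) : α (n + 2) = (n + m + 2) ^ r := by
    rw [hα _ (by omega)]
    push_cast
    ring_nf
  have hα3 : α 3 = 3 / 2 * α 2 := by
    rw [hα' 1, hα' 0, ← hcr, ← Real.mul_rpow (by linarith) (by simp; linarith)]
    congr 1
    push_cast
    linarith
  have hα12 : α 1 = α 2 / 2 := by rw [hα1, hα' 0]; simp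
  have hpos (n : ℕ) : 0 < α (n + 2) := by
    rw [hα']
    positivity
  have hconv (n : ℕ) : 2 * α (n + 1) ≤ α n + α (n + 2) := by
    match n with
    | 0 => simp only [zero_add]; linarith
    | 1 => simp only [Nat.reduceAdd]; linarith
    | k + 2 =>
      have h := two_mul_rpow_le_add_rpow hr (x := k + m + 2) (by positivity)
      rw [show k + 2 + 1 = k + 1 + 2 by rfl, hα', hα', hα']
      push_cast
      convert h using 3 <;> ring
  have hmono : Monotone α := by
    refine monotone_nat_of_le_succ fun n => ?_
    induction n with
    | zero => have := hpos 0; simp only [zero_add] at *; linarith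
    | succ k ih => linarith [hconv k]
  have hlog (k : ℕ) : α (k + 2) * α (k + 4) ≤ α (k + 3) ^ 2 := by
    have h := rpow_mul_rpow_le_sq_rpow hr0.le (x := k + m + 2) (by positivity)
    rw [show k + 4 = k + 2 + 2 by rfl, show k + 3 = k + 1 + 2 by rfl, hα', hα', hα']
    push_cast
    convert h using 3 <;> ring
  have hratio (k : ℕ) : α (k + 3) ≤ 3 / 2 * α (k + 2) := by
    rw [show k + 3 = k + 1 + 2 by rfl, hα', hα', ← hcr,
      ← Real.mul_rpow (by linarith) (by positivity)]
    refine Real.rpow_le_rpow (by positivity) ?_ hr0.le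
    push_cast
    nlinarith [mul_nonneg (Nat.cast_nonneg (α := ℝ) k) (sub_nonneg.2 hc1.le)]
  have hβmono : Monotone β := by
    intro a b hab
    have : (a : ℝ) ≤ b := by exact_mod_cast hab
    rw [hβ, hβ]
    exact mul_le_mul_of_nonneg_left
      (Real.rpow_le_rpow (by positivity) (by linarith) hs0) hγ
  intro i hi
  obtain ⟨k, rfl⟩ := Nat.exists_eq_add_of_le' hi
  simp only [show k + 2 - 1 = k + 1 by rfl, show k + 2 - 2 = k by rfl,
    show k + 2 + 1 = k + 3 by rfl, show k + 2 + 2 = k + 4 by rfl]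
  have hprod : (α (k + 2) - α (k + 1) + β (k + 2) - β (k + 1)) * (β (k + 3) - β k) ≥ 0 := by
    have h₁ := hmono (show k + 1 ≤ k + 2 by omega)
    have h₂ := hβmono (show k + 1 ≤ k + 2 by omega)
    have h₃ := hβmono (show k ≤ k + 3 by omega)
    exact mul_nonneg (by linarith) (by linarith)
  refine ⟨?_, ?_, hprod⟩
  · cases k with
    | zero =>
      have h₂ := hpos 0
      have h₄ := hpos 2
      simp only [zero_add, Nat.reduceAdd] at *
      rw [hα3, hα12]
      nlinarith [mul_pos h₂ h₄]
    | succ j =>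
      have h := four_mul_rpow_le hr (x := j + m + 2) (by positivity)
      have e₁ : α (j + 1 + 1) = (j + m + 2) ^ r := hα' j
      have e₂ : α (j + 1 + 2) = (j + m + 2 + 1) ^ r := by
        rw [hα']; push_cast; congr 1; ring
      have e₃ : α (j + 1 + 3) = (j + m + 2 + 2) ^ r := by
        rw [show j + 1 + 3 = j + 2 + 2 by rfl, hα']; push_cast; congr 1; ring
      have e₄ : α (j + 1 + 4) = (j + m + 2 + 3) ^ r := by
        rw [show j + 1 + 4 = j + 3 + 2 by rfl, hα']; push_cast; congr 1; ring
      rw [e₁, e₂, e₃, e₄]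
      linarith
  · suffices h : α (k + 3) * (α (k + 3) - α k)
        ≤ (α (k + 2) - α (k + 1)) * (4 * α (k + 4) - α (k + 1)) by linarith
    cases k with
    | zero =>
      have h₂ := hpos 0
      have h₄ := hmono (show 3 ≤ 4 by omega)
      simp only [zero_add] at *
      rw [hα3, hα12, hα0]
      nlinarith
    | succ j =>
      exact mul_sub_le_of_convex_of_logConcave (hpos j) (hmono (by omega)) (hconv (j + 1))
        (hconv (j + 2)) (hconv (j + 3)) (hlog j) (hratio j)
end

section
/- Let k ≥ 2, and let (c_i)_{i≥0} be a sequence with c_0 = 1 and c_i > 0 for i ≥ 1. (1) If for every i ≥ 1 one has 4·(a_{i+1}·c_i/c_{i+1} − a_i)·(a_i − a_{i−1}·c_{i−1}/c_i) > (b_i − b_{i−1})² and a_{i+1}/a_i > c_{i+1}/c_i, then b_{k−1} − 2·√(a_k·a_{k−1}·c_{k−1}/c_k) < x_{1,k} and x_{k,k} < b_{k−1} + 2·√(a_k·a_{k−1}·c_{k−1}/c_k). (2) If a_1 < a_2 < ⋯ (the a_i strictly increasing), 2·(a_2² − a_1²) > (b_1 − b_0)², and (a_{i+1}² − a_i²)·(a_i²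 − a_{i−1}²)/a_i² > (b_i − b_{i−1})² for every i ≥ 2, then b_{k−1} − √(2·(a_{k−1}² + a_k²)) < x_{1,k} and x_{k,k} < b_{k−1} + √(2·(a_{k−1}² + a_k²)). -/
/-- If the discriminant condition `(s - t)² A < 4 (D' - A) (A - D)` holds and `t² ≥ 4 D'`, `t > 0`,
then `2 A / t` lies strictly between the roots of `σ² - s σ + D`. -/
lemma exists_pos_quadratic_neg {A D D' s t : ℝ} (hA : 0 < A) (hAD : A < D')
    (hdisc : A * (t - s) ^ 2 < 4 * (D' - A) * (A - D)) (ht : 0 < t) (ht2 : 4 * D' ≤ t ^ 2) :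
    ∃ σ, 0 < σ ∧ t * σ = 2 * A ∧ σ ^ 2 - s * σ + D < 0 := by
  refine ⟨2 * A / t, by positivity, by field_simp, ?_⟩
  set σ := 2 * A / t with hσ
  have hσ1 : t * σ = 2 * A := by rw [hσ]; field_simp
  have hE : 0 < D' - A := by linarith
  have hval : D' * σ ^ 2 ≤ A * A := by
    have : (t * σ) ^ 2 = 4 * A ^ 2 := by rw [hσ1]; ring
    nlinarith [mul_le_mul_of_nonneg_right ht2 (sq_nonneg σ)]
  have hsq : 0 < 4 * (D' - A) * ((D' - A) * σ ^ 2 + A * (s - t) * σ + A * (A - D)) := by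
    nlinarith [sq_nonneg (2 * (D' - A) * σ + A * (s - t)), mul_lt_mul_of_pos_left hdisc hA]
  have hpos := pos_of_mul_pos_right hsq (by positivity)
  have h2 : A * (t * σ) = A * (2 * A) := by rw [hσ1]
  have h3 : A * (σ ^ 2 - s * σ + D) < A * 0 := by nlinarith
  exact lt_of_mul_lt_mul_left h3 hA.le

lemma recurrence_turan_nonneg {t A e y : ℕ → ℝ} (he0 : e 0 = 0) (hA : ∀ n, 0 < A (n + 1))
    (hAe : ∀ n, A (n + 1) < e (n + 1))
    (hdisc : ∀ n, A (n + 1) * (t (n + 1) - t n) ^ 2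
      < 4 * (e (n + 1) - A (n + 1)) * (A (n + 1) - e n))
    (hy0 : y 0 = 0) (hy1 : y 1 = 1) (hrec : ∀ n, y (n + 2) = t n * y (n + 1) - A n * y n)
    (n : ℕ) (ht : 0 < t n) (ht2 : 4 * e n ≤ t n ^ 2) :
    0 < y (n + 1) ∧ t n * y (n + 1) ≤ 2 * y (n + 2) ∧
      0 ≤ y (n + 2) ^ 2 - t n * y (n + 2) * y (n + 1) + e n * y (n + 1) ^ 2 := by
  induction n with
  | zero =>
    have hy2 : y 2 = t 0 := by simpa [hy0, hy1] using hrec 0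
    simp only [zero_add, hy1, hy2, he0]
    exact ⟨one_pos, by linarith, by nlinarith⟩
  | succ n ih =>
    have he : 0 ≤ e n := by
      cases n with
      | zero => exact he0.ge
      | succ m => exact ((hA m).trans (hAe m)).le
    obtain ⟨σ, hσ, hσt, hneg⟩ := exists_pos_quadratic_neg (hA n) (hAe n) (hdisc n) ht ht2
    have hs : 0 < t n := by
      by_contra! h
      nlinarith [mul_nonneg (neg_nonneg.2 h) hσ.le, sq_nonneg σ]
    have hs2 : 4 * e n ≤ t n ^ 2 := by nlinarith [sq_nonneg (2 * σ - t n)]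
    obtain ⟨hz, h2, hG⟩ := ih hs hs2
    have hy : 0 < y (n + 2) := by nlinarith [mul_pos hs hz]
    have hle : σ * y (n + 1) ≤ y (n + 2) := by
      by_contra! h
      have h1 : 0 ≤ (σ * y (n + 1) - y (n + 2)) * (σ * y (n + 1) + y (n + 2) - t n * y (n + 1)) :=
        mul_nonneg (by linarith) (by linarith)
      have h3 := mul_neg_of_neg_of_pos hneg (pow_pos hz 2)
      nlinarith
    have h4 : 0 ≤ A (n + 1) ^ 2 * y (n + 1) ^ 2
        - A (n + 1) * t (n + 1) * y (n + 2) * y (n + 1) + e (n + 1) * y (n + 2) ^ 2 := by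
      have hE : 0 < e (n + 1) - A (n + 1) := sub_pos.2 (hAe n)
      have hsq : 0 ≤ 4 * (e (n + 1) - A (n + 1)) * ((e (n + 1) - A (n + 1)) * y (n + 2) ^ 2
          + A (n + 1) * (t n - t (n + 1)) * y (n + 2) * y (n + 1)
          + A (n + 1) * (A (n + 1) - e n) * y (n + 1) ^ 2) := by
        have h5 := mul_le_mul_of_nonneg_right (mul_lt_mul_of_pos_left (hdisc n) (hA n)).le
          (sq_nonneg (y (n + 1)))
        nlinarith [sq_nonneg (2 * (e (n + 1) - A (n + 1)) * y (n + 2)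
          + A (n + 1) * (t n - t (n + 1)) * y (n + 1))]
      have h6 := nonneg_of_mul_nonneg_right hsq (by positivity)
      nlinarith [mul_nonneg (hA n).le hG]
    have hr := hrec (n + 1)
    refine ⟨hy, ?_, ?_⟩
    · have h7 : t (n + 1) * (σ * y (n + 1)) ≤ t (n + 1) * y (n + 2) :=
        mul_le_mul_of_nonneg_left hle ht.le
      have h8 : t (n + 1) * (σ * y (n + 1)) = 2 * A (n + 1) * y (n + 1) := by
        rw [← mul_assoc, hσt]
      rw [hr]
      linarith
    · rw [hr]
      nlinarith

lemma recurrence_pos {t A e y : ℕ → ℝ} (he0 : e 0 = 0) (hA : ∀ n, 0 < A (n + 1))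
    (hAe : ∀ n, A (n + 1) < e (n + 1))
    (hdisc : ∀ n, A (n + 1) * (t (n + 1) - t n) ^ 2
      < 4 * (e (n + 1) - A (n + 1)) * (A (n + 1) - e n))
    (hy0 : y 0 = 0) (hy1 : y 1 = 1) (hrec : ∀ n, y (n + 2) = t n * y (n + 1) - A n * y n)
    (n : ℕ) (ht : 0 < t n) (ht2 : 4 * e n ≤ t n ^ 2) : 0 < y (n + 2) := by
  obtain ⟨h1, h2, -⟩ := recurrence_turan_nonneg he0 hA hAe hdisc hy0 hy1 hrec n ht ht2
  nlinarith [mul_pos ht h1]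

lemma sq_sub_lt_of_zero {A b e q : ℕ → ℝ} {x : ℝ} (he0 : e 0 = 0) (hA : ∀ n, 0 < A (n + 1))
    (hAe : ∀ n, A (n + 1) < e (n + 1))
    (hdisc : ∀ n, A (n + 1) * (b (n + 1) - b n) ^ 2
      < 4 * (e (n + 1) - A (n + 1)) * (A (n + 1) - e n))
    (hq0 : q 0 = 0) (hq1 : q 1 = 1)
    (hrec : ∀ n, q (n + 2) = (x - b n) * q (n + 1) - A n * q n)
    (n : ℕ) (hzero : q (n + 3) = 0) : (x - b (n + 1)) ^ 2 < 4 * e (n + 1) := by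
  by_contra! h
  have hpos : 0 < (x - b (n + 1)) ^ 2 := by linarith [hA n, hAe n]
  rcases lt_or_gt_of_ne (sq_pos_iff.1 hpos) with hlt | hgt
  · have := recurrence_pos (t := fun n => b n - x) (y := fun n => (-1) ^ (n + 1) * q n)
      he0 hA hAe (fun n => by simpa using hdisc n) (by simp [hq0]) (by simp [hq1])
      (fun n => by simp only [hrec]; ring) (n + 1) (by simpa using hlt) (by nlinarith)
    simp [hzero] at this
  · have := recurrence_pos (t := fun n => x - b n) he0 hA hAe
      (fun n => by convert hdisc n using 2; ring) hq0 hq1 hrec (n + 1) hgt h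
    exact this.ne' hzero


/- Convention: `q n` denotes the paper's `q_{n-1}`, so `q 0 = 0`, `q 1 = 1`, and
`q (n+2) x = (x - b n) * q (n+1) x - a n ^ 2 * q n x`.  `x1` and `xk` are the smallest and
largest zero of `q_k = q (k+1)`.  The two parts of the statement are stated as two
implications from their respective hypotheses. -/
theorem stmt_17 (a b : ℕ → ℝ) (q : ℕ → ℝ → ℝ) (k : ℕ) (hk : 2 ≤ k)
    (ha0 : a 0 = 0) (hapos : ∀ i, 1 ≤ i → 0 < a i)
    (hq0 : ∀ x : ℝ, q 0 x = 0) (hq1 : ∀ x : ℝ, q 1 x = 1)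
    (hrec : ∀ n, ∀ x : ℝ, q (n + 2) x = (x - b n) * q (n + 1) x - a n ^ 2 * q n x)
    (x1 xk : ℝ)
    (hx1 : q (k + 1) x1 = 0) (hxk : q (k + 1) xk = 0)
    (hmin : ∀ y : ℝ, q (k + 1) y = 0 → x1 ≤ y)
    (hmax : ∀ y : ℝ, q (k + 1) y = 0 → y ≤ xk) :
    (∀ c : ℕ → ℝ, c 0 = 1 → (∀ i, 1 ≤ i → 0 < c i) →
      (∀ i, 1 ≤ i →
        4 * (a (i + 1) * c i / c (i + 1) - a i) * (a i - a (i - 1) * c (i - 1) / c i)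
            > (b i - b (i - 1)) ^ 2 ∧
          a (i + 1) / a i > c (i + 1) / c i) →
      b (k - 1) - 2 * Real.sqrt (a k * a (k - 1) * c (k - 1) / c k) < x1 ∧
        xk < b (k - 1) + 2 * Real.sqrt (a k * a (k - 1) * c (k - 1) / c k)) ∧
    ((∀ i, 1 ≤ i → a i < a (i + 1)) →
      2 * (a 2 ^ 2 - a 1 ^ 2) > (b 1 - b 0) ^ 2 →
      (∀ i, 2 ≤ i →
        (a (i + 1) ^ 2 - a i ^ 2) * (a i ^ 2 - a (i - 1) ^ 2) / a i ^ 2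
          > (b i - b (i - 1)) ^ 2) →
      b (k - 1) - Real.sqrt (2 * (a (k - 1) ^ 2 + a k ^ 2)) < x1 ∧
        xk < b (k - 1) + Real.sqrt (2 * (a (k - 1) ^ 2 + a k ^ 2))) := by
  obtain ⟨n, rfl⟩ : ∃ n, k = n + 2 := ⟨k - 2, by omega⟩
  have key : ∀ e : ℕ → ℝ, e 0 = 0 → (∀ n, a (n + 1) ^ 2 < e (n + 1)) →
      (∀ n, a (n + 1) ^ 2 * (b (n + 1) - b n) ^ 2
        < 4 * (e (n + 1) - a (n + 1) ^ 2) * (a (n + 1) ^ 2 - e n)) →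
      b (n + 1) - Real.sqrt (4 * e (n + 1)) < x1 ∧
        xk < b (n + 1) + Real.sqrt (4 * e (n + 1)) := by
    intro e he0 hAe hdisc
    have hA : ∀ n, 0 < a (n + 1) ^ 2 := fun n => pow_pos (hapos _ (by omega)) 2
    have hbound : ∀ x, q (n + 3) x = 0 → |x - b (n + 1)| < Real.sqrt (4 * e (n + 1)) :=
      fun x hx => Real.lt_sqrt_of_sq_lt (by
        rw [sq_abs]
        exact sq_sub_lt_of_zero (A := fun n => a n ^ 2) (q := fun n => q n x)
          he0 hA hAe hdisc (hq0 x) (hq1 x) (fun n => hrec n x) n hx)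
    have h1 := abs_lt.1 (hbound x1 hx1)
    have h2 := abs_lt.1 (hbound xk hxk)
    exact ⟨by linarith, by linarith⟩
  simp only [show n + 2 - 1 = n + 1 by omega]
  refine ⟨fun c hc0 hc h => ?_, fun hmono h1 h2 => ?_⟩
  · have hcpos : ∀ i, 0 < c i := fun i => by
      cases i with
      | zero => rw [hc0]; exact one_pos
      | succ m => exact hc _ (by omega)
    have := key (fun m => a (m + 1) * a m * c m / c (m + 1)) (by simp [ha0]) (fun m => ?_)
      (fun m => ?_)
    · rwa [Real.sqrt_mul (by norm_num), show Real.sqrt 4 = 2 by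
        rw [show (4 : ℝ) = 2 ^ 2 by norm_num]; exact Real.sqrt_sq (by norm_num)] at this
    · have ha := hapos (m + 1) (by omega)
      have h3 := (h (m + 1) (by omega)).2
      rw [gt_iff_lt, div_lt_div_iff₀ (hcpos _) ha] at h3
      rw [lt_div_iff₀ (hcpos _)]
      nlinarith
    · have ha := hapos (m + 1) (by omega)
      have h3 := (h (m + 1) (by omega)).1
      simp only [Nat.add_sub_cancel] at h3
      have h4 := mul_lt_mul_of_pos_left h3 (pow_pos ha 2)
      refine h4.trans_eq ?_
      have := (hcpos (m + 1)).ne'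
      have := (hcpos (m + 2)).ne'
      field_simp
  · have := key (fun m => if m = 0 then 0 else (a m ^ 2 + a (m + 1) ^ 2) / 2) (by simp)
      (fun m => ?_) (fun m => ?_)
    · simp only [Nat.succ_ne_zero, if_false] at this
      convert this using 4 <;> ring
    · have ha := hapos (m + 1) (by omega)
      have h3 := hmono (m + 1) (by omega)
      simp only [Nat.succ_ne_zero, if_false]
      nlinarith
    · have ha := hapos (m + 1) (by omega)
      simp only [Nat.succ_ne_zero, if_false]
      cases m with
      | zero =>
        have h4 := mul_lt_mul_of_pos_left h1 (pow_pos ha 2)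
        simp only [zero_add, if_true] at h4 ⊢
        linarith
      | succ m =>
        have h3 := h2 (m + 2) (by omega)
        rw [gt_iff_lt, lt_div_iff₀ (pow_pos ha 2)] at h3
        simp only [Nat.succ_ne_zero, if_false, show m + 2 - 1 = m + 1 by omega] at h3 ⊢
        linarith
end

section
/- Suppose (a_k)_{k≥1} and (b_k)_{k≥0} are nondecreasing and that for every i ≥ 1 one has 4a_i² − 3a_{i+1}² ≥ 2a_{i+1}·(b_{i+1} − b_i). Then for every k ≥ 3 the largest real zero x_{k,k} of p_k satisfies x_{k,k} < b_{k−2} + 2a_{k−2}. -/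
/-- To the right of `b N + 2 a N`, the polynomials of index at most `N + 2` are positive and
consecutive ones have ratio bounded below. -/
theorem recurrence_pos_and_ratio_bound (a b : ℕ → ℝ) (p : ℕ → ℝ) (x : ℝ) (N : ℕ) (hN : 1 ≤ N)
    (hapos : ∀ i, 1 ≤ i → 0 < a i) (hp0 : p 0 = 0) (hp1 : p 1 = 1)
    (hrec : ∀ n, a (n + 1) * p (n + 2) = (x - b n) * p (n + 1) - a n * p n)
    (hamono : ∀ i, 1 ≤ i → a i ≤ a (i + 1)) (hbmono : Monotone b)
    (hx : b N + 2 * a N ≤ x) :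
    ∀ j, j ≤ N → 0 < p (j + 1) ∧ a N * p (j + 1) ≤ a (j + 1) * p (j + 2) := by
  have hA : 0 < a N := hapos N hN
  intro j
  induction j with
  | zero =>
    intro _
    have h := hrec 0
    have hb := hbmono (Nat.zero_le N)
    simp only [zero_add, hp0, hp1] at h ⊢
    exact ⟨one_pos, by linarith⟩
  | succ j ih =>
    intro hj
    obtain ⟨hpos, hratio⟩ := ih (by omega)
    have haj : 0 < a (j + 1) := hapos _ (by omega)
    have hle : a (j + 1) ≤ a N :=
      Nat.le_induction (m := j + 1) (P := fun n _ => a (j + 1) ≤ a n) le_rfl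
        (fun n hn h => h.trans (hamono n (by omega))) N hj
    have hb := hbmono hj
    have hpos' : 0 < p (j + 2) := by
      have : 0 < a (j + 1) * p (j + 2) := lt_of_lt_of_le (mul_pos hA hpos) hratio
      exact (mul_pos_iff_of_pos_left haj).1 this
    refine ⟨hpos', ?_⟩
    have hpp : p (j + 1) ≤ p (j + 2) := by
      have := mul_le_mul_of_nonneg_right hle hpos'.le
      exact le_of_mul_le_mul_left (hratio.trans this) hA
    have h1 : a (j + 1) * p (j + 1) ≤ a N * p (j + 2) :=
      mul_le_mul hle hpp hpos.le hA.le
    have h2 : 2 * a N * p (j + 2) ≤ (x - b (j + 1)) * p (j + 2) :=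
      mul_le_mul_of_nonneg_right (by linarith) hpos'.le
    have h := hrec (j + 1)
    simp only [add_assoc, Nat.reduceAdd] at h ⊢
    linarith

/- Convention: `p n` denotes the paper's `p_{n-1}`, so `p 0 = 0`, `p 1 = 1`, and the
orthonormal recurrence reads `a (n+1) * p (n+2) x = (x - b n) * p (n+1) x - a n * p n x`.
`xk` is the largest real zero `x_{k,k}` of `p_k = p (k+1)`. -/
theorem stmt_18 (a b : ℕ → ℝ) (p : ℕ → ℝ → ℝ)
    (ha0 : a 0 = 0) (hapos : ∀ i, 1 ≤ i → 0 < a i)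
    (hp0 : ∀ x : ℝ, p 0 x = 0) (hp1 : ∀ x : ℝ, p 1 x = 1)
    (hrec : ∀ n, ∀ x : ℝ,
      a (n + 1) * p (n + 2) x = (x - b n) * p (n + 1) x - a n * p n x)
    (hamono : ∀ i, 1 ≤ i → a i ≤ a (i + 1)) (hbmono : ∀ i, b i ≤ b (i + 1))
    (hcond : ∀ i, 1 ≤ i →
      4 * a i ^ 2 - 3 * a (i + 1) ^ 2 ≥ 2 * a (i + 1) * (b (i + 1) - b i)) :
    ∀ k, 3 ≤ k → ∀ xk : ℝ, p (k + 1) xk = 0 → (∀ y : ℝ, p (k + 1) y = 0 → y ≤ xk) →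
      xk < b (k - 2) + 2 * a (k - 2) := by
  intro k hk xk hzero _
  obtain ⟨m, rfl⟩ : ∃ m, k = m + 3 := ⟨k - 3, by omega⟩
  rw [show m + 3 - 2 = m + 1 by omega]
  by_contra! hx
  have key := recurrence_pos_and_ratio_bound a b (fun n => p n xk) xk (m + 1) (by omega) hapos
    (hp0 xk) (hp1 xk) (fun n => hrec n xk) hamono (monotone_nat_of_le_succ hbmono) hx (m + 1) le_rfl
  have h := hrec (m + 2) xk
  have hA := hapos (m + 1) (by omega)
  have hB := hapos (m + 2) (by omega)
  have hAB := hamono (m + 1) (by omega)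
  have hd := hbmono (m + 1)
  have hc := hcond (m + 1) (by omega)
  simp only [add_assoc, Nat.reduceAdd] at key h hzero hc hAB hd
  obtain ⟨hP, hPQ⟩ := key
  rw [hzero, mul_zero] at h
  generalize a (m + 1) = A at *
  generalize a (m + 2) = B at *
  generalize p (m + 2) xk = P at *
  generalize p (m + 3) xk = Q at *
  obtain ⟨d, hd'⟩ : ∃ d, d = b (m + 2) - b (m + 1) := ⟨_, rfl⟩
  rw [← hd'] at hc
  have hQ : 0 < Q := (mul_pos_iff_of_pos_left hB).1 ((mul_pos hA hP).trans_le hPQ)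
  have h1 : (2 * A - d) * Q ≤ B * P := by
    have := mul_le_mul_of_nonneg_right (show 2 * A - d ≤ xk - b (m + 2) by linarith) hQ.le
    linarith
  have h2 : A * (2 * A - d) ≤ B ^ 2 := by
    refine le_of_mul_le_mul_right ?_ hQ
    have := mul_le_mul_of_nonneg_left h1 hA.le
    have := mul_le_mul_of_nonneg_left hPQ hB.le
    linarith
  have h3 : 3 * B ^ 2 ≤ 4 * A ^ 2 := by
    have : 0 ≤ 2 * B * d := mul_nonneg (by linarith) (by linarith)
    linarith
  have h4 : 2 * B < 3 * A := by
    refine lt_of_pow_lt_pow_left₀ 2 (by linarith) ?_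
    have := pow_pos hB 2
    linarith
  have h5 := mul_le_mul_of_nonneg_left h2 hB.le
  have h6 := mul_le_mul_of_nonneg_left hc hA.le
  have h7 : 0 < B ^ 2 * (3 * A - 2 * B) := mul_pos (pow_pos hB 2) (by linarith)
  have h8 : 0 ≤ A ^ 2 * (B - A) := mul_nonneg (sq_nonneg A) (by linarith)
  linarith
end

section
/- Let r ≥ 1 and 0 ≤ s < r+1 be fixed reals, put ρ = (2/3)·min{1, r − s + 1} and m = 1/((3/2)^{1/r} − 1) − 2, and let γ ≥ 0 satisfy γ ≤ (m+2)^{r−s+1}/(2s) if 0 < s < 1 and γ ≤ (m+3)^{r−s+1}/(3s) if 1 ≤ s < r+1. Assume a_i = i^r + o(i^{r−ρ}) and b_i = γ·i^s + o(i^{r−ρ}) as i → ∞ (i.e., (a_i − i^r)/i^{r−ρ} → 0 and (b_i − γ·i^s)/i^{r−ρ} → 0). Let δ > 0 be fixed with δ < 2r if 0 ≤ s < r, δ < (2+γ)·r if s = r, and δ < γ·s if r < s < r+1. Then for every ε > 0 there is a K such that for all k ≥ K every real zero x of p_k satisfies x ≤ γ·k^s + k^r·(2 − 2^{−4/3}·δ^{2/3}·k^{−ρ})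 + ε·k^{r−ρ}. -/
open Filter Topology

/-- A positive supersolution of the three-term recurrence at `x` forces positivity at `x`. -/
theorem recurrence_pos_of_supersolution {a b q v : ℕ → ℝ} {x : ℝ} {k : ℕ}
    (ha0 : a 0 = 0) (hapos : ∀ n, 1 ≤ n → 0 < a n) (hq0 : q 0 = 0) (hq1 : q 1 = 1)
    (hrec : ∀ n, a (n + 1) * q (n + 2) = (x - b n) * q (n + 1) - a n * q n)
    (hv : ∀ n, n ≤ k + 1 → 0 < v n)
    (hsuper : ∀ n, n < k → a (n + 1) * v (n + 2) + b n * v (n + 1) + a n * v n ≤ x * v (n + 1)) :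
    0 < q (k + 1) := by
  have key : ∀ n, n ≤ k → 0 < q (n + 1) ∧ q n * v (n + 1) ≤ q (n + 1) * v n := by
    intro n
    induction n with
    | zero =>
      intro _
      have := hv 0 (by omega)
      simp [hq0, hq1, this.le]
    | succ n ih =>
      intro hn
      obtain ⟨h1, h2⟩ := ih (by omega)
      have ha : 0 ≤ a n := by
        rcases Nat.eq_zero_or_pos n with rfl | h
        · exact ha0.ge
        · exact (hapos n h).le
      have ha' := hapos (n + 1) (by omega)
      have hv1 := hv (n + 1) (by omega)
      have hv2 := hv (n + 2) (by omega)
      have e1 := mul_le_mul_of_nonneg_left (hsuper n (by omega)) h1.le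
      have e2 := mul_le_mul_of_nonneg_left h2 ha
      have e3 := congrArg (· * v (n + 1)) (hrec n)
      have h3 : q (n + 1) * v (n + 2) ≤ q (n + 2) * v (n + 1) :=
        le_of_mul_le_mul_left (by linarith) ha'
      exact ⟨pos_of_mul_pos_left ((mul_pos h1 hv2).trans_le h3) hv1.le, h3⟩
  exact (key k le_rfl).1

/-- A sequence that is `o(i ^ q)` with `q > 0` is small up to index `k` relative to `k ^ q`. -/
theorem eventually_forall_le_abs_le_mul_rpow {d : ℕ → ℝ} {q η : ℝ} (hq : 0 < q) (hη : 0 < η)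
    (hd : Tendsto (fun i : ℕ => d i / (i : ℝ) ^ q) atTop (𝓝 0)) :
    ∀ᶠ k : ℕ in atTop, ∀ i, i ≤ k → |d i| ≤ η * (k : ℝ) ^ q := by
  obtain ⟨N, hN⟩ := Metric.tendsto_atTop.1 hd η hη
  have hlim : Tendsto (fun k : ℕ => η * (k : ℝ) ^ q) atTop atTop :=
    ((tendsto_rpow_atTop hq).comp tendsto_natCast_atTop_atTop).const_mul_atTop hη
  filter_upwards [hlim.eventually_ge_atTop (∑ i ∈ Finset.range (N + 1), |d i|)] with k hk i hik
  rcases lt_or_ge i (N + 1) with h | h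
  · exact (Finset.single_le_sum (f := fun i => |d i|) (fun _ _ => abs_nonneg _)
      (Finset.mem_range.2 h)).trans hk
  · have hi : (0 : ℝ) < i := by exact_mod_cast (by omega : 0 < i)
    have hiq : 0 < (i : ℝ) ^ q := Real.rpow_pos_of_pos hi q
    have h1 := hN i (by omega)
    rw [Real.dist_eq, sub_zero, abs_div, abs_of_pos hiq, div_lt_iff₀ hiq] at h1
    have h2 : (i : ℝ) ^ q ≤ (k : ℝ) ^ q :=
      Real.rpow_le_rpow hi.le (by exact_mod_cast hik) hq.le
    exact h1.le.trans (mul_le_mul_of_nonneg_left h2 hη.le)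

/-- Tangent-line bound for the convex function `x ↦ x ^ t`. -/
theorem mul_sub_mul_rpow_le_rpow_sub_rpow {t x y : ℝ} (ht : 1 ≤ t) (hy : 0 < y) (hx : 0 ≤ x) :
    t * (x - y) * y ^ (t - 1) ≤ x ^ t - y ^ t := by
  have h := one_add_mul_self_le_rpow_one_add (s := x / y - 1) (by linarith [div_nonneg hx hy.le]) ht
  rw [add_sub_cancel, Real.div_rpow hx hy.le, le_div_iff₀ (Real.rpow_pos_of_pos hy t)] at h
  have e : y ^ t = y ^ (t - 1) * y := by
    rw [Real.rpow_sub_one hy.ne', div_mul_cancel₀ _ hy.ne']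
  have : (1 + t * (x / y - 1)) * y ^ t = y ^ t + t * (x - y) * y ^ (t - 1) := by
    rw [e]; field_simp
  linarith

/-- For `j ≤ x / (2 t)`, the power `(x - j) ^ u` with `u ≤ t` is at least half of `x ^ u`. -/
theorem half_rpow_le_sub_rpow {t u x j : ℝ} (ht : 1 ≤ t) (hut : u ≤ t) (hx : 0 < x)
    (hj0 : 0 ≤ j) (hj : 2 * t * j ≤ x) : x ^ u / 2 ≤ (x - j) ^ u := by
  have hjx : j ≤ x / 2 := by nlinarith
  have h1 : 0 < 1 - j / x := by
    rw [sub_pos, div_lt_one hx]; linarith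
  have h := one_add_mul_self_le_rpow_one_add (s := -(j / x)) (by linarith) ht
  have h2 : t * (j / x) ≤ 1 / 2 := by
    rw [mul_div_assoc', div_le_iff₀ hx]; linarith
  have h3 : (1 - j / x) ^ t ≤ (1 - j / x) ^ u :=
    Real.rpow_le_rpow_of_exponent_ge h1 (by linarith [div_nonneg hj0 hx.le]) hut
  have h4 : 1 / 2 ≤ (1 - j / x) ^ u := by
    rw [← sub_eq_add_neg] at h; linarith
  have e : x - j = x * (1 - j / x) := by field_simp
  rw [e, Real.mul_rpow hx.le h1.le]
  nlinarith [Real.rpow_pos_of_pos hx u]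

/-- The dominant one of the two power gaps `2 (x ^ r - y ^ r)` and `γ (x ^ s - y ^ s)`. -/
theorem exists_dominant_power {r s γ δ ρ : ℝ} (hr : 1 ≤ r) (hs0 : 0 ≤ s) (hs1 : s < r + 1)
    (hρ : ρ = 2 / 3 * min 1 (r - s + 1)) (hγ0 : 0 ≤ γ)
    (hδ1 : s < r → δ < 2 * r) (hδ2 : s = r → δ < (2 + γ) * r) (hδ3 : r < s → δ < γ * s) :
    ∃ D t : ℝ, 0 ≤ D ∧ r ≤ t ∧ t < r + 1 ∧ ρ = 2 / 3 * (r - t + 1) ∧ δ < D * t ∧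
      ∀ x y : ℝ, 0 ≤ y → y ≤ x → D * (x ^ t - y ^ t) ≤ 2 * (x ^ r - y ^ r) + γ * (x ^ s - y ^ s) := by
  have gap : ∀ {e x y : ℝ}, 0 ≤ e → 0 ≤ y → y ≤ x → 0 ≤ x ^ e - y ^ e := fun he hy hxy =>
    sub_nonneg.2 (Real.rpow_le_rpow hy hxy he)
  rcases lt_trichotomy s r with h | h | h
  · refine ⟨2, r, by norm_num, le_rfl, by linarith, ?_, hδ1 h, fun x y hy hxy => ?_⟩
    · rw [hρ, min_eq_left (by linarith)]; ring
    · linarith [mul_nonneg hγ0 (gap hs0 hy hxy)]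
  · subst h
    refine ⟨2 + γ, s, by linarith, le_rfl, by linarith, ?_, hδ2 rfl, fun x y hy hxy => ?_⟩
    · rw [hρ, min_eq_left (by linarith)]; ring
    · linarith
  · refine ⟨γ, s, hγ0, h.le, hs1, ?_, hδ3 h, fun x y hy hxy => ?_⟩
    · rw [hρ, min_eq_right (by linarith)]
    · linarith [gap (zero_le_one.trans hr) hy hxy]

/-- A length scale `J` for which a parabolic cap of height at most `1 / 2` on the last `J` indices
has enough curvature, while the remaining indices have a large enough gap. -/
theorem eventually_exists_cap_length {r t D δ c ρ : ℝ} (hr : 1 ≤ r) (hrt : r ≤ t) (ht : t < r + 1)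
    (hρ : ρ = 2 / 3 * (r - t + 1)) (hδ0 : 0 < δ) (hδ : δ < D * t)
    (hc0 : 0 < c) (hc : c ^ 3 = δ ^ 2 / 16) :
    ∀ᶠ k : ℕ in atTop, ∃ J : ℕ, J ≤ k ∧ c * (k : ℝ) ^ (-ρ) * (J : ℝ) ^ 2 ≤ 1 / 2 ∧
      (k : ℝ) ^ r / 2 ≤ ((k : ℝ) - J) ^ r ∧ 0 < (k : ℝ) - J ∧ 1 ≤ J ∧
      c * (k : ℝ) ^ (r - ρ) ≤ D * ((k : ℝ) ^ t - ((k : ℝ) - J + 1) ^ t) := by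
  have ht1 : 1 ≤ t := hr.trans hrt
  have hρ0 : 0 < ρ := by rw [hρ]; linarith
  have hρ1 : ρ ≤ 2 / 3 := by rw [hρ]; linarith
  set θ : ℝ := 1 / √(2 * c) with hθ
  have hsq : √(2 * c) ^ 2 = 2 * c := Real.sq_sqrt (by linarith)
  have hsp : 0 < √(2 * c) := Real.sqrt_pos.2 (by linarith)
  have hθ0 : 0 < θ := by positivity
  have hθ2 : c * θ ^ 2 = 1 / 2 := by
    rw [hθ, div_pow, hsq]; field_simp
  have hgap : c < δ * θ / 2 := by
    refine lt_of_pow_lt_pow_left₀ 2 (by positivity) (lt_of_mul_lt_mul_left ?_ hc0.le)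
    calc c * c ^ 2 = δ ^ 2 / 16 := by rw [← hc]; ring
      _ < δ ^ 2 / 8 := by nlinarith [sq_pos_of_pos hδ0]
      _ = c * (δ * θ / 2) ^ 2 := by linear_combination (-(δ ^ 2 / 4)) * hθ2
  have hw : Tendsto (fun k : ℕ => (k : ℝ) ^ (ρ / 2)) atTop atTop :=
    (tendsto_rpow_atTop (by linarith)).comp tendsto_natCast_atTop_atTop
  have hk : Tendsto (fun k : ℕ => (k : ℝ) ^ (1 - ρ / 2)) atTop atTop :=
    (tendsto_rpow_atTop (by linarith)).comp tendsto_natCast_atTop_atTop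
  filter_upwards [hw.eventually_ge_atTop (δ / (δ * θ / 2 - c)), hw.eventually_ge_atTop (2 / θ),
    hk.eventually_ge_atTop (2 * t * θ), eventually_gt_atTop 0] with k h1 h2 h3 hkpos
  have hk0 : (0 : ℝ) < k := by exact_mod_cast hkpos
  set w : ℝ := (k : ℝ) ^ (ρ / 2) with hwdef
  have hw0 : 0 < w := Real.rpow_pos_of_pos hk0 _
  rw [div_le_iff₀ (by linarith)] at h1
  rw [div_le_iff₀ hθ0] at h2
  have hJle : ((⌊θ * w⌋₊ : ℕ) : ℝ) ≤ θ * w := Nat.floor_le (by positivity)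
  have hJgt : θ * w - 1 < ((⌊θ * w⌋₊ : ℕ) : ℝ) := Nat.sub_one_lt_floor _
  generalize ⌊θ * w⌋₊ = J at hJle hJgt
  have hkw : (k : ℝ) ^ (1 - ρ / 2) * w = k := by
    rw [hwdef, ← Real.rpow_add hk0]; simp
  have hJk : 2 * t * J ≤ k := by
    rw [← hkw]; nlinarith
  have hJ0 : (0 : ℝ) ≤ J := Nat.cast_nonneg J
  have hJk2 : (J : ℝ) ≤ k / 2 := by nlinarith
  have hJ1 : (1 : ℝ) ≤ J := by linarith
  refine ⟨J, ?_, ?_, half_rpow_le_sub_rpow ht1 hrt hk0 hJ0 hJk, by linarith,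
    by exact_mod_cast hJ1, ?_⟩
  · have : (J : ℝ) ≤ k := by linarith
    exact_mod_cast this
  · have hww : (k : ℝ) ^ (-ρ) * w ^ 2 = 1 := by
      rw [hwdef, ← Real.rpow_mul_natCast hk0.le, ← Real.rpow_add hk0]; simp
    have hα : 0 < (k : ℝ) ^ (-ρ) := Real.rpow_pos_of_pos hk0 _
    have hJ2 : (J : ℝ) ^ 2 ≤ (θ * w) ^ 2 := pow_le_pow_left₀ hJ0 hJle 2
    calc c * (k : ℝ) ^ (-ρ) * (J : ℝ) ^ 2 ≤ c * (k : ℝ) ^ (-ρ) * (θ * w) ^ 2 := by gcongr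
      _ = (c * θ ^ 2) * ((k : ℝ) ^ (-ρ) * w ^ 2) := by ring
      _ = 1 / 2 := by rw [hww, hθ2]; ring
  · have hy : 0 < (k : ℝ) - J + 1 := by linarith
    have e1 := mul_sub_mul_rpow_le_rpow_sub_rpow ht1 hy hk0.le
    have e2 := half_rpow_le_sub_rpow (u := t - 1) ht1 (by linarith) hk0 hJ0 hJk
    have e3 : ((k : ℝ) - J) ^ (t - 1) ≤ ((k : ℝ) - J + 1) ^ (t - 1) :=
      Real.rpow_le_rpow (by linarith) (by linarith) (by linarith)
    have hD : 0 < D := by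
      by_contra! h; nlinarith
    have hk' : (k : ℝ) ^ (r - ρ) = (k : ℝ) ^ (t - 1) * w := by
      rw [hwdef, ← Real.rpow_add hk0]; congr 1; rw [hρ]; ring
    have hP : 0 < (k : ℝ) ^ (t - 1) := Real.rpow_pos_of_pos hk0 _
    have e4 : c * w ≤ D * t * (J - 1) / 2 := by nlinarith
    calc c * (k : ℝ) ^ (r - ρ) = (c * w) * (k : ℝ) ^ (t - 1) := by rw [hk']; ring
      _ ≤ (D * t * (J - 1) / 2) * (k : ℝ) ^ (t - 1) := by gcongr
      _ = D * (t * (J - 1) * ((k : ℝ) ^ (t - 1) / 2)) := by ring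
      _ ≤ D * (t * (k - (k - J + 1)) * ((k : ℝ) - J + 1) ^ (t - 1)) := by
          rw [show (k : ℝ) - (k - J + 1) = J - 1 by ring]
          have hJ2 : 0 ≤ (J : ℝ) - 1 := by linarith
          gcongr
          exact e2.trans e3
      _ ≤ _ := by gcongr

/-- The parabolic cap is a supersolution of the recurrence with coefficients `i ^ r`, `γ i ^ s`. -/
theorem parabolic_cap_supersolution {r s γ α : ℝ} {k J n : ℕ} (hr : 0 ≤ r) (hs : 0 ≤ s)
    (hγ : 0 ≤ γ) (hα : 0 ≤ α) (hn : n < k) (hJ : α * (J : ℝ) ^ 2 ≤ 1 / 2)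
    (hkJ : 0 < (k : ℝ) - J) (hhalf : (k : ℝ) ^ r / 2 ≤ ((k : ℝ) - J) ^ r) (hJ1 : 1 ≤ J)
    (hgap : α * (k : ℝ) ^ r ≤ 2 * ((k : ℝ) ^ r - ((k : ℝ) - J + 1) ^ r)
      + γ * ((k : ℝ) ^ s - ((k : ℝ) - J + 1) ^ s))
    {U : ℝ → ℝ} (hU : ∀ z, U z = 1 - α * max 0 z ^ 2) :
    ((n + 1 : ℕ) : ℝ) ^ r * U ((n + J - k : ℝ) + 1) + γ * (n : ℝ) ^ s * U (n + J - k)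
        + (n : ℝ) ^ r * U ((n + J - k : ℝ) - 1)
      ≤ (γ * (k : ℝ) ^ s + 2 * (k : ℝ) ^ r - α * (k : ℝ) ^ r) * U (n + J - k) := by
  have hn0 : (0 : ℝ) ≤ n := Nat.cast_nonneg n
  have hnk : (n : ℝ) + 1 ≤ k := by exact_mod_cast hn
  have hJ1' : (1 : ℝ) ≤ J := by exact_mod_cast hJ1
  push_cast
  have hs1 : (n : ℝ) ^ s ≤ (k : ℝ) ^ s := Real.rpow_le_rpow hn0 (by linarith) hs
  have hr0 : 0 ≤ (n : ℝ) ^ r := Real.rpow_nonneg hn0 r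
  have hr1 : (n : ℝ) ^ r ≤ ((n : ℝ) + 1) ^ r := Real.rpow_le_rpow hn0 (by linarith) hr
  have hr2 : ((n : ℝ) + 1) ^ r ≤ (k : ℝ) ^ r := Real.rpow_le_rpow (by linarith) hnk hr
  rcases le_or_gt (n + J) k with h | h
  · have hz : (n + J - k : ℝ) ≤ 0 := by
      have : (n : ℝ) + J ≤ k := by exact_mod_cast h
      linarith
    have hU0 : U (n + J - k) = 1 := by rw [hU, max_eq_left hz]; ring
    have hUm : U ((n + J - k : ℝ) - 1) = 1 := by rw [hU, max_eq_left (by linarith)]; ring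
    have hUp : U ((n + J - k : ℝ) + 1) ≤ 1 := by
      rw [hU]; linarith [mul_nonneg hα (sq_nonneg (max 0 ((n + J - k : ℝ) + 1)))]
    have hr3 : ((n : ℝ) + 1) ^ r ≤ ((k : ℝ) - J + 1) ^ r :=
      Real.rpow_le_rpow (by linarith) (by linarith) hr
    have hs3 : (n : ℝ) ^ s ≤ ((k : ℝ) - J + 1) ^ s :=
      Real.rpow_le_rpow hn0 (by linarith) hs
    rw [hU0, hUm]
    nlinarith [mul_le_mul_of_nonneg_left hUp (hr0.trans hr1), mul_le_mul_of_nonneg_left hs3 hγ]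
  · have hz : 1 ≤ (n + J - k : ℝ) := by
      have : (k : ℝ) + 1 ≤ n + J := by exact_mod_cast h
      linarith
    have hzJ : (n + J - k : ℝ) ≤ J - 1 := by linarith
    have hr3 : ((k : ℝ) - J) ^ r ≤ ((n : ℝ) + 1) ^ r :=
      Real.rpow_le_rpow hkJ.le (by linarith) hr
    generalize (n + J - k : ℝ) = z at hz hzJ
    have hU0 : U z = 1 - α * z ^ 2 := by rw [hU, max_eq_right (by linarith)]
    have hUm : U (z - 1) = 1 - α * (z - 1) ^ 2 := by rw [hU, max_eq_right (by linarith)]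
    have hUp : U (z + 1) = 1 - α * (z + 1) ^ 2 := by rw [hU, max_eq_right (by linarith)]
    have hsm : ∀ y : ℝ, 0 ≤ y → y ≤ J → α * y ^ 2 ≤ 1 / 2 := fun y hy hyJ =>
      (mul_le_mul_of_nonneg_left (pow_le_pow_left₀ hy hyJ 2) hα).trans hJ
    have hm := hsm (z - 1) (by linarith) (by linarith)
    have h0 := hsm z (by linarith) (by linarith)
    have hα2 : 0 ≤ α * z ^ 2 := mul_nonneg hα (sq_nonneg z)
    have hsum : U (z + 1) + U (z - 1) = 2 * U z - 2 * α := by rw [hU0, hUm, hUp]; ring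
    have hU1 : U z ≤ 1 := by linarith
    have hUpos : 0 ≤ U z := by linarith
    have hUmpos : 0 ≤ U (z - 1) := by linarith
    have hk0 : 0 ≤ (k : ℝ) ^ r := by linarith
    have f1 := mul_le_mul_of_nonneg_right hr1 hUmpos
    have f2 : ((n : ℝ) + 1) ^ r * U (z + 1) + ((n : ℝ) + 1) ^ r * U (z - 1)
        = ((n : ℝ) + 1) ^ r * (2 * U z) - ((n : ℝ) + 1) ^ r * (2 * α) := by
      rw [← mul_add, hsum]; ring
    have f3 := mul_le_mul_of_nonneg_right hr2 (by linarith : 0 ≤ 2 * U z)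
    have f4 := mul_le_mul_of_nonneg_right (hhalf.trans hr3) (by linarith : 0 ≤ 2 * α)
    have f5 := mul_le_mul_of_nonneg_right (mul_le_mul_of_nonneg_left hs1 hγ) hUpos
    have f6 := mul_le_mul_of_nonneg_left hU1 (mul_nonneg hα hk0)
    linarith


/- Convention: `p n` denotes the paper's `p_{n-1}`, so `p 0 = 0`, `p 1 = 1`, and the
orthonormal recurrence reads `a (n+1) * p (n+2) x = (x - b n) * p (n+1) x - a n * p n x`;
the paper's `p_k` is `p (k+1)` here.  All powers with real exponents are `Real.rpow`. -/
theorem stmt_19 (r s γ δ m ρ : ℝ) (a b : ℕ → ℝ) (p : ℕ → ℝ → ℝ)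
    (hr : 1 ≤ r) (hs0 : 0 ≤ s) (hs1 : s < r + 1)
    (hρ : ρ = 2 / 3 * min 1 (r - s + 1))
    (hm : m = 1 / ((3 / 2 : ℝ) ^ (1 / r) - 1) - 2)
    (hγ0 : 0 ≤ γ)
    (hγ1 : 0 < s → s < 1 → γ ≤ (m + 2) ^ (r - s + 1) / (2 * s))
    (hγ2 : 1 ≤ s → γ ≤ (m + 3) ^ (r - s + 1) / (3 * s))
    (ha0 : a 0 = 0) (hapos : ∀ k, 1 ≤ k → 0 < a k)
    (hp0 : ∀ x : ℝ, p 0 x = 0) (hp1 : ∀ x : ℝ, p 1 x = 1)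
    (hrec : ∀ n, ∀ x : ℝ,
      a (n + 1) * p (n + 2) x = (x - b n) * p (n + 1) x - a n * p n x)
    (haasymp : Filter.Tendsto
      (fun i : ℕ => (a i - (i : ℝ) ^ r) / (i : ℝ) ^ (r - ρ)) Filter.atTop (nhds 0))
    (hbasymp : Filter.Tendsto
      (fun i : ℕ => (b i - γ * (i : ℝ) ^ s) / (i : ℝ) ^ (r - ρ)) Filter.atTop (nhds 0))
    (hδ0 : 0 < δ)
    (hδ1 : s < r → δ < 2 * r) (hδ2 : s = r → δ < (2 + γ) * r) (hδ3 : r < s → δ < γ * s) :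
    ∀ ε : ℝ, 0 < ε → ∃ K : ℕ, ∀ k, K ≤ k → ∀ x : ℝ, p (k + 1) x = 0 →
      x ≤ γ * (k : ℝ) ^ s
        + (k : ℝ) ^ r * (2 - (2 : ℝ) ^ (-(4 / 3) : ℝ) * δ ^ ((2 : ℝ) / 3) * (k : ℝ) ^ (-ρ))
        + ε * (k : ℝ) ^ (r - ρ) := by
  intro ε hε
  obtain ⟨D, t, hD, hrt, ht, hρt, hδt, hdom⟩ :=
    exists_dominant_power hr hs0 hs1 hρ hγ0 hδ1 hδ2 hδ3
  set c : ℝ := (2 : ℝ) ^ (-(4 / 3) : ℝ) * δ ^ ((2 : ℝ) / 3) with hcdef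
  have hc0 : 0 < c := by positivity
  have hc : c ^ 3 = δ ^ 2 / 16 := by
    rw [hcdef, mul_pow, ← Real.rpow_mul_natCast (by norm_num), ← Real.rpow_mul_natCast hδ0.le]
    norm_num [Real.rpow_neg]
    ring
  have hq : 0 < r - ρ := by rw [hρt]; linarith
  obtain ⟨K, hK⟩ := eventually_atTop.1
    ((eventually_exists_cap_length hr hrt ht hρt hδ0 hδt hc0 hc).and
      ((eventually_forall_le_abs_le_mul_rpow hq (by linarith : 0 < ε / 6) haasymp).and
        ((eventually_forall_le_abs_le_mul_rpow hq (by linarith : 0 < ε / 6) hbasymp).and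
          (eventually_gt_atTop 0))))
  refine ⟨K, fun k hk x hx => ?_⟩
  obtain ⟨⟨J, hJk, hJ, hhalf, hkJ, hJ1, hgap⟩, hA, hB, hkpos⟩ := hK k hk
  have hk0 : (0 : ℝ) < k := by exact_mod_cast hkpos
  by_contra! hlt
  set α : ℝ := c * (k : ℝ) ^ (-ρ) with hαdef
  have hα : 0 < α := mul_pos hc0 (Real.rpow_pos_of_pos hk0 _)
  have hαk : α * (k : ℝ) ^ r = c * (k : ℝ) ^ (r - ρ) := by
    rw [hαdef, mul_assoc, ← Real.rpow_add hk0]; ring_nf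
  have hJ1' : (1 : ℝ) ≤ J := by exact_mod_cast hJ1
  rw [← hαk] at hgap
  have hgap' := hgap.trans (hdom k ((k : ℝ) - J + 1) (by linarith) (by linarith))
  set E : ℝ := (k : ℝ) ^ (r - ρ) with hE
  have hE0 : 0 < E := Real.rpow_pos_of_pos hk0 _
  let U : ℝ → ℝ := fun z => 1 - α * max 0 z ^ 2
  have hU : ∀ z, U z = 1 - α * max 0 z ^ 2 := fun _ => rfl
  have hUle : ∀ z, U z ≤ 1 := fun z => by
    rw [hU]; linarith [mul_nonneg hα.le (sq_nonneg (max 0 z))]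
  have hUge : ∀ z : ℝ, z ≤ J → 1 / 2 ≤ U z := fun z hz => by
    have h1 : max 0 z ^ 2 ≤ (J : ℝ) ^ 2 :=
      pow_le_pow_left₀ (le_max_left _ _) (max_le (by linarith) hz) 2
    rw [hU]; linarith [mul_le_mul_of_nonneg_left h1 hα.le]
  have hpos : 0 < p (k + 1) x := by
    refine recurrence_pos_of_supersolution (q := fun n => p n x)
      (v := fun n : ℕ => U ((n : ℝ) - 1 + J - k)) ha0 hapos (hp0 x) (hp1 x)
      (fun n => hrec n x) (fun n hn => ?_) (fun n hn => ?_)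
    · have : (n : ℝ) ≤ k + 1 := by exact_mod_cast hn
      linarith [hUge ((n : ℝ) - 1 + J - k) (by linarith)]
    · have hmodel := parabolic_cap_supersolution (by linarith) hs0 hγ0 hα.le hn hJ hkJ hhalf hJ1
        hgap' hU
      have hnk : (n : ℝ) + 1 ≤ k := by exact_mod_cast hn
      have e1 : ((n + 2 : ℕ) : ℝ) - 1 + J - k = (n + J - k : ℝ) + 1 := by push_cast; ring
      have e2 : ((n + 1 : ℕ) : ℝ) - 1 + J - k = (n + J - k : ℝ) := by push_cast; ring
      have e3 : (n : ℝ) - 1 + J - k = (n + J - k : ℝ) - 1 := by ring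
      simp only [e1, e2, e3]
      have herr : ∀ {f g y : ℝ}, |f - g| ≤ ε / 6 * E → 0 ≤ y → y ≤ 1 →
          f * y ≤ g * y + ε / 6 * E := fun {f g y} hfg hy0 hy1 => by
        have h1 := (le_abs_self _).trans hfg
        have h2 : (f - g) * y ≤ ε / 6 * E * y := mul_le_mul_of_nonneg_right h1 hy0
        have h3 : ε / 6 * E * y ≤ ε / 6 * E := mul_le_of_le_one_right (by positivity) hy1
        linarith
      have u1 := hUge ((n + J - k : ℝ) + 1) (by linarith)
      have u2 := hUge (n + J - k : ℝ) (by linarith)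
      have u3 := hUge ((n + J - k : ℝ) - 1) (by linarith)
      have g1 := herr (hA (n + 1) hn) (by linarith) (hUle ((n + J - k : ℝ) + 1))
      have g2 := herr (hB n hn.le) (by linarith) (hUle (n + J - k : ℝ))
      have g3 := herr (hA n hn.le) (by linarith) (hUle ((n + J - k : ℝ) - 1))
      have g4 := mul_le_mul_of_nonneg_left u2 (by positivity : 0 ≤ ε * E)
      have g5 := mul_le_mul_of_nonneg_right hlt.le (by linarith : 0 ≤ U (n + J - k : ℝ))
      linarith
  exact hpos.ne' hx
end
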